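/- arXiv:0902.4899 — 2 statements merged into one kernel-verified Lean document; each statement's English description precedes it below -/
import Mathlib

section
/- For every n ≥ 2, the multilinear (degree (1,…,1)) component of B_3(A_n) has dimension (n−2)·2^{n−2}: if P ⊆ A denotes the ℂ-span of the n! monomials x_{σ(1)} x_{σ(2)} ⋯ x_{σ(n)} for σ ∈ S_n, then dim_ℂ ((L_3 ∩ P)/(L_4 ∩ P)) = (n−2)·2^{n−2}. -/
/-- The lower central series of the free algebra `A_n = FreeAlgebra ℂ (Fin n)`,
as a chain of `ℂ`-subspaces: `lcs n 1 = A`, `lcs n (m+1) = span {[a,w] : a ∈ A, w ∈ lcs n m}`.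
(The value at `0` is junk, set to `⊤`.) -/
def lcs (n : ℕ) : ℕ → Submodule ℂ (FreeAlgebra ℂ (Fin n))
  | 0 => ⊤
  | 1 => ⊤
  | m + 2 => Submodule.span ℂ
      {y | ∃ a w, w ∈ lcs n (m + 1) ∧ y = a * w - w * a}

/-- For `g ∈ A` and a `ℂ`-subspace `V ⊆ A`, `[g, V] = span {[g,w] : w ∈ V}`. -/
def brS {n : ℕ} (g : FreeAlgebra ℂ (Fin n)) (V : Submodule ℂ (FreeAlgebra ℂ (Fin n))) :
    Submodule ℂ (FreeAlgebra ℂ (Fin n)) :=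
  Submodule.span ℂ {y | ∃ w ∈ V, y = g * w - w * g}
/-- The multilinear component: the ℂ-span of the `n!` monomials
`x_{σ(1)} ⋯ x_{σ(n)}`, `σ ∈ S_n`. -/
def multilinearPart (n : ℕ) : Submodule ℂ (FreeAlgebra ℂ (Fin n)) :=
  Submodule.span ℂ
    {y | ∃ σ : Equiv.Perm (Fin n), y = (List.ofFn fun i : Fin n => FreeAlgebra.ι ℂ (σ i)).prod}

section GrassmannLike

variable {B ι : Type*} [Ring B] [Algebra ℂ B]

/-- The symmetrised product `(ab + ba)/2`. -/
noncomputable def symProd (a b : B) : B := (2⁻¹ : ℂ) • (a * b + b * a)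

/-- Half of the commutator, `(ab - ba)/2`. -/
noncomputable def halfComm (a b : B) : B := (2⁻¹ : ℂ) • (a * b - b * a)

theorem mul_eq_symProd_add_halfComm (a b : B) : a * b = symProd a b + halfComm a b := by
  unfold symProd halfComm; module

theorem halfComm_antisymm (a b : B) : halfComm a b = -halfComm b a := by
  unfold halfComm; module

/-- The iterated symmetrised product of the letters of a list. -/
noncomputable def symWord (x : ι → B) : List ι → B
  | [] => 1
  | a :: l => symProd (x a) (symWord x l)

/-- The product `{a₁,a₂}{a₃,a₄}⋯` of half commutators (`0` for lists of odd length). -/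
noncomputable def altWord (x : ι → B) : List ι → B
  | [] => 1
  | [_] => 0
  | a :: b :: l => halfComm (x a) (x b) * altWord x l

/-- `altWord` with a pending first letter. -/
noncomputable def altWordFrom (x : ι → B) (a : ι) (l : List ι) : B := altWord x (a :: l)

@[simp] theorem symWord_nil (x : ι → B) : symWord x [] = 1 := rfl
@[simp] theorem symWord_cons (x : ι → B) (a l) :
    symWord x (a :: l) = symProd (x a) (symWord x l) := rfl
@[simp] theorem altWord_nil (x : ι → B) : altWord x [] = 1 := by rw [altWord]
@[simp] theorem altWord_cons (x : ι → B) (a l) :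
    altWord x (a :: l) = altWordFrom x a l := rfl
@[simp] theorem altWordFrom_nil (x : ι → B) (a) : altWordFrom x a [] = 0 := by
  rw [altWordFrom, altWord]
@[simp] theorem altWordFrom_cons (x : ι → B) (a b l) :
    altWordFrom x a (b :: l) = halfComm (x a) (x b) * altWord x l := by rw [altWordFrom, altWord]

theorem altWord_odd (x : ι → B) (l : List ι) :
    (Odd l.length → altWord x l = 0) ∧ ∀ a, Even l.length → altWordFrom x a l = 0 := by
  induction l with
  | nil => simp
  | cons b l ih =>
    refine ⟨fun h => ?_, fun a h => ?_⟩
    · rw [altWord_cons]; exact ih.2 b (by simpa [Nat.odd_add_one] using h)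
    · rw [altWordFrom_cons, ih.1 (by simpa [Nat.even_add_one] using h), mul_zero]

variable (hB : ∀ a b c : B, (a * b - b * a) * c = c * (a * b - b * a))
include hB

theorem halfComm_mul_comm (a b c : B) : halfComm a b * c = c * halfComm a b := by
  unfold halfComm; rw [smul_mul_assoc, mul_smul_comm, hB]

theorem symProd_left_comm (a b c : B) :
    symProd a (symProd b c) = symProd b (symProd a c) := by
  have h := sub_eq_zero.mpr (hB a b c)
  rw [← sub_eq_zero, ← smul_zero (4⁻¹ : ℂ), ← h]
  simp only [symProd, mul_add, add_mul, sub_mul, mul_sub, smul_mul_assoc, mul_smul_comm, mul_assoc]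
  module

theorem halfComm_mul_halfComm (a b c d : B) :
    halfComm a b * halfComm c d = -(halfComm a c * halfComm b d) := by
  have h := sub_eq_zero.mpr (hB (b * c) a d)
  have e : (b * c * a - a * (b * c)) * d - d * (b * c * a - a * (b * c)) =
      b * ((c * a - a * c) * d - d * (c * a - a * c)) + (b * d - d * b) * (c * a - a * c)
      + (b * a - a * b) * (c * d - d * c) + ((b * a - a * b) * d - d * (b * a - a * b)) * c := by
    noncomm_ring
  rw [e, hB c a d, hB b a d, sub_self, sub_self, mul_zero, zero_mul, zero_add, add_zero,
    ← hB c a (b * d - d * b)] at h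
  rw [← sub_eq_zero, ← smul_zero (-4⁻¹ : ℂ), ← h]
  simp only [halfComm, sub_mul, mul_sub, smul_mul_assoc, mul_smul_comm, mul_assoc]
  module

theorem symWord_perm (x : ι → B) {l l' : List ι} (h : l.Perm l') :
    symWord x l = symWord x l' := by
  induction h with
  | nil => rfl
  | cons a _ ih => simp [ih]
  | swap a b l => simp [symProd_left_comm hB (x a) (x b)]
  | trans _ _ h1 h2 => exact h1.trans h2

theorem halfComm_symProd (a b c : B) :
    halfComm a (symProd b c) = symProd b (halfComm a c) + halfComm a b * c := by
  have h := halfComm_mul_comm hB a b c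
  have : halfComm a b * c = symProd (halfComm a b) c := by
    unfold symProd; rw [h, ← two_smul ℂ, smul_smul]; norm_num
  rw [this]
  simp only [halfComm, symProd, mul_add, add_mul, sub_mul, mul_sub, smul_mul_assoc, mul_smul_comm, mul_assoc]
  module

theorem symProd_halfComm_mul (a b c d : B) :
    symProd d (halfComm a b * c) = halfComm a b * symProd d c := by
  have h := halfComm_mul_comm hB a b d
  simp only [symProd, mul_smul_comm, mul_add, mul_assoc]
  rw [← mul_assoc d, ← h, mul_assoc]

variable [DecidableEq ι]

theorem halfComm_symWord (x : ι → B) (a : ι) (l : List ι) (hl : l.Nodup) :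
    halfComm (x a) (symWord x l) =
      ∑ r ∈ l.toFinset, halfComm (x a) (x r) * symWord x (l.erase r) := by
  induction l with
  | nil => simp [halfComm]
  | cons b l ih =>
    rw [List.nodup_cons] at hl
    rw [symWord_cons, halfComm_symProd hB, ih hl.2, List.toFinset_cons,
      Finset.sum_insert (by simpa using hl.1), add_comm]
    congr 1
    · simp
    · have : ∀ y, symProd (x b) y = LinearMap.mulLeft ℂ (x b) ((2⁻¹ : ℂ) • y) +
          LinearMap.mulRight ℂ (x b) ((2⁻¹ : ℂ) • y) := fun y => by simp [symProd]
      rw [this, Finset.smul_sum, map_sum, map_sum, ← Finset.sum_add_distrib]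
      refine Finset.sum_congr rfl fun r hr => ?_
      have hr' : b ≠ r := by rintro rfl; exact hl.1 (by simpa using hr)
      rw [← this, List.erase_cons_tail (by simpa using hr'), symWord_cons,
        symProd_halfComm_mul hB]

theorem sum_halfComm_altWord (x : ι → B) (l : List ι) (hl : l.Nodup) (a : ι) :
    (∑ r ∈ l.toFinset, halfComm (x a) (x r) * altWord x (l.erase r) = altWordFrom x a l) ∧
    ∀ b, ∑ r ∈ l.toFinset, halfComm (x a) (x r) * altWordFrom x b (l.erase r) = 0 := by
  induction l generalizing a with
  | nil => simp
  | cons c l ih =>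
    rw [List.nodup_cons] at hl
    have hr' : ∀ r ∈ l.toFinset, c ≠ r := by
      rintro r hr rfl; exact hl.1 (by simpa using hr)
    have hc : c ∉ l.toFinset := by simpa using hl.1
    refine ⟨?_, fun b => ?_⟩
    · rw [List.toFinset_cons, Finset.sum_insert hc, altWordFrom_cons]
      rw [Finset.sum_congr rfl (g := fun r => halfComm (x a) (x r) * altWordFrom x c (l.erase r)),
        (ih hl.2 a).2 c]
      · simp
      · intro r hr
        rw [List.erase_cons_tail (by simpa using hr' r hr), altWord_cons]
    · rw [List.toFinset_cons, Finset.sum_insert hc]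
      rw [Finset.sum_congr rfl (g := fun r => halfComm (x b) (x c) *
        (halfComm (x a) (x r) * altWord x (l.erase r))), ← Finset.mul_sum, (ih hl.2 a).1]
      · rw [List.erase_cons_head]
        cases l with
        | nil => simp
        | cons d l =>
          rw [altWordFrom_cons, altWordFrom_cons, ← mul_assoc, ← mul_assoc, ← add_mul,
            halfComm_mul_halfComm hB (x a), halfComm_mul_halfComm hB (x b), ← neg_add, ← add_mul,
            halfComm_antisymm (x b) (x a)]
          simp
      · intro r hr
        rw [List.erase_cons_tail (by simpa using hr' r hr), altWordFrom_cons, ← mul_assoc,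
          halfComm_mul_comm hB, mul_assoc]

end GrassmannLike

section Sign

variable {ι : Type*} [LinearOrder ι]

/-- The sign of a pair: `1` if increasing, `-1` if decreasing, `0` on the diagonal. -/
noncomputable def pairSign (a b : ι) : ℂ := if a < b then 1 else if b < a then -1 else 0

theorem pairSign_swap (a b : ι) : pairSign b a = -pairSign a b := by
  unfold pairSign
  rcases lt_trichotomy a b with h | h | h <;> simp [h, h.not_gt]

theorem pairSign_mul_self {a b : ι} (h : a ≠ b) : pairSign a b * pairSign a b = 1 := by
  unfold pairSign
  rcases lt_or_gt_of_ne h with h | h <;> simp [h, h.not_gt]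

/-- The product of the signs of `(a, b)` over `b ∈ l`. -/
noncomputable def crossOne (a : ι) (l : List ι) : ℂ := (l.map (pairSign a)).prod

/-- The product of the signs of all pairs `(a, b)` with `a ∈ u` and `b ∈ v`. -/
noncomputable def crossSign (u v : List ι) : ℂ := (u.map fun a => crossOne a v).prod

/-- The sign of a word (`0` if a letter is repeated). -/
noncomputable def wordSign : List ι → ℂ
  | [] => 1
  | a :: l => crossOne a l * wordSign l

@[simp] theorem crossOne_nil (a : ι) : crossOne a [] = 1 := rfl
@[simp] theorem crossOne_cons (a b : ι) (l) : crossOne a (b :: l) = pairSign a b * crossOne a l := by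
  simp [crossOne]
@[simp] theorem crossOne_append (a : ι) (u v) :
    crossOne a (u ++ v) = crossOne a u * crossOne a v := by simp [crossOne]
@[simp] theorem crossSign_nil (v : List ι) : crossSign [] v = 1 := rfl
@[simp] theorem crossSign_cons (a : ι) (u v) :
    crossSign (a :: u) v = crossOne a v * crossSign u v := by simp [crossSign]
@[simp] theorem wordSign_nil : wordSign ([] : List ι) = 1 := rfl
@[simp] theorem wordSign_cons (a : ι) (l) : wordSign (a :: l) = crossOne a l * wordSign l := rfl

@[simp] theorem crossSign_nil_right (u : List ι) : crossSign u [] = 1 := by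
  induction u with
  | nil => rfl
  | cons a u ih => simp [ih]

theorem crossSign_cons_right (a : ι) (u v) :
    crossSign v (a :: u) = (-1) ^ v.length * crossOne a v * crossSign v u := by
  induction v with
  | nil => simp
  | cons b v ih => simp only [crossSign_cons, ih, crossOne_cons, List.length_cons, pow_succ,
      pairSign_swap a b]; ring

theorem crossSign_comm (u v : List ι) :
    crossSign v u = (-1) ^ (u.length * v.length) * crossSign u v := by
  induction u with
  | nil => simp
  | cons a u ih =>
    rw [crossSign_cons_right, ih, crossSign_cons, List.length_cons, add_mul, pow_add, one_mul]
    ring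

theorem wordSign_append (u v : List ι) :
    wordSign (u ++ v) = crossSign u v * wordSign u * wordSign v := by
  induction u with
  | nil => simp
  | cons a u ih => simp [ih]; ring

theorem crossOne_perm (a : ι) {l l' : List ι} (h : l.Perm l') : crossOne a l = crossOne a l' :=
  (h.map _).prod_eq

theorem crossSign_perm {u u' v v' : List ι} (hu : u.Perm u') (hv : v.Perm v') :
    crossSign u v = crossSign u' v' := by
  unfold crossSign
  rw [(hu.map _).prod_eq]
  simp only [crossOne_perm _ hv]

theorem crossSign_append_right (u v w : List ι) :
    crossSign u (v ++ w) = crossSign u v * crossSign u w := by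
  induction u with
  | nil => simp
  | cons a u ih => simp [ih]; ring

theorem crossOne_mul_self {a : ι} {l : List ι} (h : a ∉ l) : crossOne a l * crossOne a l = 1 := by
  induction l with
  | nil => simp
  | cons b l ih =>
    simp only [List.mem_cons, not_or] at h
    rw [crossOne_cons, mul_mul_mul_comm, ih h.2, pairSign_mul_self h.1, one_mul]

theorem wordSign_mul_self {l : List ι} (h : l.Nodup) : wordSign l * wordSign l = 1 := by
  induction l with
  | nil => simp
  | cons b l ih =>
    rw [List.nodup_cons] at h
    rw [wordSign_cons, mul_mul_mul_comm, ih h.2, crossOne_mul_self h.1, one_mul]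

end Sign

section GrassmannExpansion

variable {B ι : Type*} [Ring B] [Algebra ℂ B]
  (hB : ∀ a b c : B, (a * b - b * a) * c = c * (a * b - b * a))
include hB

theorem altWord_central (x : ι → B) (l : List ι) :
    (∀ c, altWord x l * c = c * altWord x l) ∧
      ∀ a c, altWordFrom x a l * c = c * altWordFrom x a l := by
  induction l with
  | nil => simp
  | cons b l ih =>
    refine ⟨fun c => by simpa using ih.2 b c, fun a c => ?_⟩
    rw [altWordFrom_cons, mul_assoc, ih.1, ← mul_assoc, halfComm_mul_comm hB, mul_assoc]

theorem altWord_perm_aux [LinearOrder ι] (x : ι → B) {l l' : List ι} (h : l.Perm l') :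
    ∃ ε : ℂ, wordSign l' = ε * wordSign l ∧ altWord x l' = ε • altWord x l ∧
      ∀ a, altWordFrom x a l' = ε • altWordFrom x a l := by
  induction h with
  | nil => exact ⟨1, by simp⟩
  | @cons a l l' h ih =>
    obtain ⟨ε, h1, h2, h3⟩ := ih
    refine ⟨ε, ?_, by simpa using h3 a, fun b => ?_⟩
    · rw [wordSign_cons, wordSign_cons, h1, crossOne_perm a h]; ring
    · rw [altWordFrom_cons, altWordFrom_cons, h2, mul_smul_comm]
  | swap a b l =>
    refine ⟨-1, ?_, ?_, fun c => ?_⟩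
    · simp only [wordSign_cons, crossOne_cons, pairSign_swap b a]; ring
    · simp [halfComm_antisymm (x a) (x b)]
    · cases l with
      | nil => simp
      | cons d l =>
        simp only [altWordFrom_cons, altWord_cons, ← mul_assoc]
        rw [halfComm_mul_halfComm hB (x c)]; simp
  | trans _ _ ih ih' =>
    obtain ⟨ε, h1, h2, h3⟩ := ih
    obtain ⟨ε', h1', h2', h3'⟩ := ih'
    exact ⟨ε' * ε, by rw [h1', h1, mul_assoc], by rw [h2', h2, smul_smul],
      fun a => by rw [h3', h3, smul_smul]⟩

theorem altWord_perm [LinearOrder ι] (x : ι → B) {l l' : List ι} (h : l.Perm l') (hl : l.Nodup) :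
    altWord x l' = (wordSign l' * wordSign l) • altWord x l := by
  obtain ⟨ε, h1, h2, -⟩ := altWord_perm_aux hB x h
  rw [h2, h1, mul_assoc, wordSign_mul_self hl, mul_one]

theorem prod_eq_sum_symWord_mul_altWord [DecidableEq ι] (x : ι → B) (l : List ι) (hl : l.Nodup) :
    (l.map x).prod = ∑ T ∈ l.toFinset.powerset,
      symWord x (l.filter (· ∉ T)) * altWord x (l.filter (· ∈ T)) := by
  induction l with
  | nil => simp
  | cons a l ih =>
    rw [List.nodup_cons] at hl
    have ha : a ∉ l.toFinset := by simpa using hl.1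
    have haT : ∀ T ∈ l.toFinset.powerset, a ∉ T := fun T hT h => ha (Finset.mem_powerset.1 hT h)
    rw [List.map_cons, List.prod_cons, ih hl.2, mul_eq_symProd_add_halfComm, List.toFinset_cons,
      Finset.sum_powerset_insert ha]
    congr 1
    · have : ∀ y, symProd (x a) y = LinearMap.mulLeft ℂ (x a) ((2⁻¹ : ℂ) • y) +
          LinearMap.mulRight ℂ (x a) ((2⁻¹ : ℂ) • y) := fun y => by simp [symProd]
      rw [this, Finset.smul_sum, map_sum, map_sum, ← Finset.sum_add_distrib]
      refine Finset.sum_congr rfl fun T hT => ?_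
      rw [← this, List.filter_cons_of_pos (by simpa using haT T hT),
        List.filter_cons_of_neg (by simpa using haT T hT), symWord_cons]
      simp only [symProd, smul_mul_assoc, add_mul, mul_assoc, (altWord_central hB x _).1 (x a)]
    · have : ∀ y, halfComm (x a) y = LinearMap.mulLeft ℂ (x a) ((2⁻¹ : ℂ) • y) -
          LinearMap.mulRight ℂ (x a) ((2⁻¹ : ℂ) • y) := fun y => by simp [halfComm, smul_sub]
      rw [this, Finset.smul_sum, map_sum, map_sum, ← Finset.sum_sub_distrib]
      have e1 : ∀ T ∈ l.toFinset.powerset,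
          LinearMap.mulLeft ℂ (x a) ((2⁻¹ : ℂ) •
              (symWord x (l.filter (· ∉ T)) * altWord x (l.filter (· ∈ T)))) -
            LinearMap.mulRight ℂ (x a) ((2⁻¹ : ℂ) •
              (symWord x (l.filter (· ∉ T)) * altWord x (l.filter (· ∈ T)))) =
          ∑ r ∈ l.toFinset \ T, halfComm (x a) (x r) *
            (symWord x (l.filter (· ∉ insert r T)) * altWord x (l.filter (· ∈ T))) := by
        intro T hT
        have e : halfComm (x a) (symWord x (l.filter (· ∉ T)) * altWord x (l.filter (· ∈ T))) =
            halfComm (x a) (symWord x (l.filter (· ∉ T))) * altWord x (l.filter (· ∈ T)) := by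
          simp only [halfComm, smul_mul_assoc, sub_mul, mul_assoc,
            (altWord_central hB x _).1 (x a)]
        rw [← this, e, halfComm_symWord hB x a _ (hl.2.filter _), Finset.sum_mul]
        have : (l.filter (· ∉ T)).toFinset = l.toFinset \ T := by ext; simp
        rw [this]
        refine Finset.sum_congr rfl fun r hr => ?_
        rw [(hl.2.filter _).erase_eq_filter, List.filter_filter, mul_assoc]
        congr 4
        ext y
        simp only [Finset.mem_insert]
        by_cases h : y = r <;> simp [h]
      rw [Finset.sum_congr rfl e1]
      have e2 : ∀ T ∈ l.toFinset.powerset,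
          symWord x ((a :: l).filter (· ∉ insert a T)) * altWord x ((a :: l).filter (· ∈ insert a T))
          = ∑ r ∈ T, halfComm (x a) (x r) *
            (symWord x (l.filter (· ∉ T)) * altWord x (l.filter (· ∈ T.erase r))) := by
        intro T hT
        have hT' := Finset.mem_powerset.1 hT
        rw [List.filter_cons_of_neg (by simp), List.filter_cons_of_pos (by simp), altWord_cons]
        have f1 : l.filter (· ∉ insert a T) = l.filter (· ∉ T) := by
          refine List.filter_congr fun y hy => ?_
          have : y ≠ a := by rintro rfl; exact hl.1 hy
          simp [this]
        have f2 : l.filter (· ∈ insert a T) = l.filter (· ∈ T) := by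
          refine List.filter_congr fun y hy => ?_
          have : y ≠ a := by rintro rfl; exact hl.1 hy
          simp [this]
        rw [f1, f2, ← (sum_halfComm_altWord hB x _ (hl.2.filter _) a).1]
        have : (l.filter (· ∈ T)).toFinset = T := by
          ext y; simpa using fun h => List.mem_toFinset.1 (hT' h)
        rw [this, Finset.mul_sum]
        refine Finset.sum_congr rfl fun r hr => ?_
        rw [(hl.2.filter _).erase_eq_filter, List.filter_filter, ← mul_assoc, ← mul_assoc,
          ← halfComm_mul_comm hB]
        congr 3
        ext y
        simp only [Finset.mem_erase]
        by_cases h : y = r <;> simp [h]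
      rw [Finset.sum_congr rfl e2, Finset.sum_sigma', Finset.sum_sigma']
      refine Finset.sum_bij' (fun p _ => ⟨insert p.2 p.1, p.2⟩) (fun p _ => ⟨p.1.erase p.2, p.2⟩)
        ?_ ?_ ?_ ?_ ?_
      · rintro ⟨T, r⟩ h
        simp only [Finset.mem_sigma, Finset.mem_powerset, Finset.mem_sdiff] at h ⊢
        exact ⟨Finset.insert_subset h.2.1 h.1, Finset.mem_insert_self _ _⟩
      · rintro ⟨T, r⟩ h
        simp only [Finset.mem_sigma, Finset.mem_powerset, Finset.mem_sdiff] at h ⊢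
        exact ⟨(Finset.erase_subset _ _).trans h.1, h.1 h.2, Finset.notMem_erase _ _⟩
      · rintro ⟨T, r⟩ h
        simp only [Finset.mem_sigma, Finset.mem_sdiff] at h
        simp [Finset.erase_insert h.2.2]
      · rintro ⟨T, r⟩ h
        simp only [Finset.mem_sigma] at h
        simp [Finset.insert_erase h.2]
      · rintro ⟨T, r⟩ h
        simp only [Finset.mem_sigma, Finset.mem_sdiff] at h
        simp only [Finset.erase_insert h.2.2]

end GrassmannExpansion

theorem eq_zero_of_antisymm_of_jacobi {A : Type*} (G : A → A → A → A → A → ℂ)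
    (h1 : ∀ d p a b c, G p d a b c = -G d p a b c)
    (h2 : ∀ d p a b c, G d a p b c = -G d p a b c)
    (h3 : ∀ d p a b c, G d p a c b = -G d p a b c)
    (h4 : ∀ d p a b c, G d p a b c + G d p b c a + G d p c a b = 0) (d p a b c : A) :
    G d p a b c = 0 := by
  have e1 := h4 d p a b c
  have e2 := h4 p a d b c
  have e3 := h4 a d p b c
  have e4 := h4 d b p a c
  have e5 := h4 d c p a b
  have e6 := h4 p b d a c
  have e7 := h4 p c d a b
  have e8 := h4 a b d p c
  have e9 := h4 a c d p b
  have e10 := h4 b c d p a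
  clear h4
  grind

section Functionals

attribute [local instance] LieRing.ofAssociativeRing

variable {A ι : Type*} [Ring A] [Algebra ℂ A]

theorem apply_lie_mul_lie_eq_zero {f : A →ₗ[ℂ] ℂ} (hf : ∀ a b c d : A, f ⁅a, ⁅b, ⁅c, d⁆⁆⁆ = 0)
    (d p a b c : A) : f ⁅d, p * ⁅a, ⁅b, c⁆⁆⁆ = 0 := by
  refine eq_zero_of_antisymm_of_jacobi (fun d p a b c => f ⁅d, p * ⁅a, ⁅b, c⁆⁆⁆) ?_ ?_ ?_ ?_ d p a b c
  · intro d p a b c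
    rw [eq_neg_iff_add_eq_zero, ← map_add]
    have : ⁅p, d * ⁅a, ⁅b, c⁆⁆⁆ + ⁅d, p * ⁅a, ⁅b, c⁆⁆⁆ =
        ⁅p, ⁅d, ⁅a, ⁅b, c⁆⁆⁆⁆ + ⁅d * p, ⁅a, ⁅b, c⁆⁆⁆ := by
      simp only [Ring.lie_def]; noncomm_ring
    rw [this, map_add, hf, hf, add_zero]
  · intro d p a b c
    rw [eq_neg_iff_add_eq_zero, ← map_add, ← lie_add]
    have : a * ⁅p, ⁅b, c⁆⁆ + p * ⁅a, ⁅b, c⁆⁆ = ⁅p * a, ⁅b, c⁆⁆ + ⁅a, ⁅p, ⁅b, c⁆⁆⁆ := by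
      simp only [Ring.lie_def]; noncomm_ring
    rw [this, lie_add, map_add, hf, hf, add_zero]
  · intro d p a b c
    rw [← lie_skew b c, lie_neg, mul_neg, lie_neg, map_neg, neg_neg]
  · intro d p a b c
    simp only [← map_add, ← lie_add, ← mul_add]
    rw [lie_jacobi, mul_zero, lie_zero, map_zero]

theorem apply_lie_mul_lie_mul_eq_zero {f : A →ₗ[ℂ] ℂ}
    (hf : ∀ a b c d : A, f ⁅a, ⁅b, ⁅c, d⁆⁆⁆ = 0) (d p q a b c : A) :
    f ⁅d, p * ⁅a, ⁅b, c⁆⁆ * q⁆ = 0 := by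
  have : p * ⁅a, ⁅b, c⁆⁆ * q = p * q * ⁅a, ⁅b, c⁆⁆ - p * ⁅q, ⁅a, ⁅b, c⁆⁆⁆ := by
    simp only [Ring.lie_def]; noncomm_ring
  rw [this, lie_sub, map_sub, apply_lie_mul_lie_eq_zero hf, apply_lie_mul_lie_eq_zero hf, sub_zero]

/-- The largest two-sided ideal contained in the kernel of a functional, as a congruence. -/
def kernelCon (g : A →ₗ[ℂ] ℂ) : RingCon A where
  r a b := ∀ p q, g (p * (a - b) * q) = 0
  iseqv := ⟨fun a p q => by simp,
    fun h p q => by rw [← neg_sub, mul_neg, neg_mul, map_neg, h, neg_zero],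
    fun {a b c} h h' p q => by
      rw [← sub_add_sub_cancel a b c, mul_add, add_mul, map_add, h, h', add_zero]⟩
  add' {a b c d} h h' p q := by
    rw [add_sub_add_comm, mul_add, add_mul, map_add, h, h', add_zero]
  mul' {a b c d} h h' p q := by
    have : p * (a * c - b * d) * q = p * (a - b) * (c * q) + p * b * (c - d) * q := by noncomm_ring
    rw [this, map_add, h, h', add_zero]

/-- The quotient map by `kernelCon g`. -/
def kernelConMk (g : A →ₗ[ℂ] ℂ) : A →ₐ[ℂ] (kernelCon g).Quotient :=
  { (kernelCon g).mk' with commutes' := fun _ => rfl }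

theorem apply_eq_of_kernelConMk_eq {g : A →ₗ[ℂ] ℂ} {a b : A}
    (h : kernelConMk g a = kernelConMk g b) : g a = g b := by
  have h' : kernelCon g a b := (kernelCon g).eq.1 h
  simpa [sub_eq_zero] using h' 1 1

section Map

variable {B : Type*} [Ring B] [Algebra ℂ B] (φ : A →ₐ[ℂ] B) (x : ι → A)

theorem map_symWord (l : List ι) : φ (symWord x l) = symWord (φ ∘ x) l := by
  induction l with
  | nil => simp
  | cons a l ih => simp [symProd, ih]

theorem map_altWord (l : List ι) : φ (altWord x l) = altWord (φ ∘ x) l ∧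
    ∀ a, φ (altWordFrom x a l) = altWordFrom (φ ∘ x) a l := by
  induction l with
  | nil => simp
  | cons a l ih =>
    exact ⟨by simpa using ih.2 a, fun b => by simp [halfComm, ih.1]⟩

end Map

theorem exists_apply_word_eq_sum [LinearOrder ι] {g : A →ₗ[ℂ] ℂ}
    (hg : ∀ p q a b c : A, g (p * ⁅a, ⁅b, c⁆⁆ * q) = 0) (x : ι → A) (l₀ : List ι) (hl₀ : l₀.Nodup) :
    ∃ h : Finset ι → ℂ, (∀ T ⊆ l₀.toFinset, Odd T.card → h T = 0) ∧ ∀ l : List ι, l.Perm l₀ →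
      g (l.map x).prod = ∑ T ∈ l₀.toFinset.powerset, wordSign (l.filter (· ∈ T)) * h T := by
  refine ⟨fun T => wordSign (l₀.filter (· ∈ T)) *
    g (symWord x (l₀.filter (· ∉ T)) * altWord x (l₀.filter (· ∈ T))), fun T hT h => ?_,
    fun l hl => ?_⟩
  · have hc : (l₀.filter (· ∈ T)).length = T.card := by
      rw [← List.toFinset_card_of_nodup (hl₀.filter _)]
      congr 1; ext y; simpa using fun h => List.mem_toFinset.1 (hT h)
    dsimp only
    rw [(altWord_odd x _).1 (hc ▸ h), mul_zero, map_zero, mul_zero]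
  · have hB : ∀ a b c : (kernelCon g).Quotient, (a * b - b * a) * c = c * (a * b - b * a) := by
      have hs : Function.Surjective (kernelConMk g) := (kernelCon g).mk'_surjective
      intro a b c
      obtain ⟨a, rfl⟩ := hs a
      obtain ⟨b, rfl⟩ := hs b
      obtain ⟨c, rfl⟩ := hs c
      simp only [← map_mul, ← map_sub]
      refine (kernelCon g).eq.2 fun p q => ?_
      have : p * ((a * b - b * a) * c - c * (a * b - b * a)) * q = - (p * ⁅c, ⁅a, b⁆⁆ * q) := by
        simp only [Ring.lie_def]; noncomm_ring
      rw [this, map_neg, hg, neg_zero]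
    have hn : l.Nodup := hl.nodup_iff.2 hl₀
    have key : g (l.map x).prod = g (∑ T ∈ l.toFinset.powerset,
        (wordSign (l.filter (· ∈ T)) * wordSign (l₀.filter (· ∈ T))) •
          (symWord x (l₀.filter (· ∉ T)) * altWord x (l₀.filter (· ∈ T)))) := by
      apply apply_eq_of_kernelConMk_eq
      rw [map_list_prod, List.map_map, prod_eq_sum_symWord_mul_altWord hB _ _ hn, map_sum]
      refine Finset.sum_congr rfl fun T _ => ?_
      rw [map_smul, map_mul, map_symWord, (map_altWord _ _ _).1,
        symWord_perm hB _ (hl.filter _),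
        altWord_perm hB _ (hl.symm.filter (· ∈ T)) (hl₀.filter _), mul_smul_comm]
    rw [key, map_sum, List.toFinset_eq_of_perm _ _ hl]
    refine Finset.sum_congr rfl fun T _ => ?_
    rw [map_smul, smul_eq_mul, mul_assoc]

end Functionals

section Words

variable {ι : Type*}

/-- The monomial of the free algebra spelled by a list of letters. -/
noncomputable def word (l : List ι) : FreeAlgebra ℂ ι := (l.map (FreeAlgebra.ι ℂ)).prod

theorem word_append (u v : List ι) : word (u ++ v) = word u * word v := by simp [word]

theorem word_singleton (i : ι) : word [i] = FreeAlgebra.ι ℂ i := by simp [word]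

@[simp] theorem word_nil : word ([] : List ι) = 1 := rfl

theorem word_cons (i : ι) (l : List ι) : word (i :: l) = word [i] * word l := by simp [word]

theorem basisFreeMonoid_ofList (l : List ι) :
    FreeAlgebra.basisFreeMonoid ℂ ι (FreeMonoid.ofList l) = word l := by
  simp [FreeAlgebra.basisFreeMonoid, word, FreeAlgebra.equivMonoidAlgebraFreeMonoid,
    FreeMonoid.lift_apply]

/-- The linear map on the free algebra with prescribed values on monomials. -/
noncomputable def onWords {V : Type*} [AddCommGroup V] [Module ℂ V] (φ : List ι → V) :
    FreeAlgebra ℂ ι →ₗ[ℂ] V :=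
  (FreeAlgebra.basisFreeMonoid ℂ ι).constr ℂ fun m => φ (FreeMonoid.toList m)

@[simp] theorem onWords_word {V : Type*} [AddCommGroup V] [Module ℂ V] (φ : List ι → V)
    (l : List ι) : onWords φ (word l) = φ l := by
  rw [← basisFreeMonoid_ofList, onWords, Module.Basis.constr_basis, FreeMonoid.toList_ofList]

theorem eq_of_word {V : Type*} [AddCommGroup V] [Module ℂ V] {f g : FreeAlgebra ℂ ι →ₗ[ℂ] V}
    (h : ∀ l, f (word l) = g (word l)) : f = g :=
  (FreeAlgebra.basisFreeMonoid ℂ ι).ext fun m => by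
    simpa [← basisFreeMonoid_ofList] using h (FreeMonoid.toList m)

/-- The span of the monomials spelled by the rearrangements of a list. -/
noncomputable def content (p : List ι) : Submodule ℂ (FreeAlgebra ℂ ι) :=
  Submodule.span ℂ (word '' {l | l.Perm p})

theorem word_mem_content {l p : List ι} (h : l.Perm p) : word l ∈ content p :=
  Submodule.subset_span ⟨l, h, rfl⟩

theorem content_congr {p q : List ι} (h : p.Perm q) : content p = content q := by
  rw [content, content]
  congr 2; ext l; exact ⟨fun h' => h'.trans h, fun h' => h'.trans h.symm⟩

theorem eqOn_content {V : Type*} [AddCommGroup V] [Module ℂ V] {f g : FreeAlgebra ℂ ι →ₗ[ℂ] V}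
    {p : List ι} (h : ∀ l, l.Perm p → f (word l) = g (word l)) {a : FreeAlgebra ℂ ι}
    (ha : a ∈ content p) : f a = g a := by
  refine LinearMap.eqOn_span (s := word '' {l | l.Perm p}) ?_ ha
  rintro _ ⟨l, hl, rfl⟩
  exact h l hl

theorem mul_mem_content {p q : List ι} {a b : FreeAlgebra ℂ ι} (ha : a ∈ content p)
    (hb : b ∈ content q) : a * b ∈ content (p ++ q) := by
  have := Submodule.mul_mem_mul ha hb
  rw [content, content, Submodule.span_mul_span] at this
  refine Submodule.span_mono ?_ this
  rintro _ ⟨_, ⟨u, hu, rfl⟩, _, ⟨v, hv, rfl⟩, rfl⟩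
  exact ⟨u ++ v, hu.append hv, word_append u v⟩

theorem mul_mem_content' {p q : List ι} {a b : FreeAlgebra ℂ ι} (ha : a ∈ content p)
    (hb : b ∈ content q) : b * a ∈ content (p ++ q) :=
  content_congr List.perm_append_comm ▸ mul_mem_content hb ha

theorem lie_mem_content {p q : List ι} {a b : FreeAlgebra ℂ ι} (ha : a ∈ content p)
    (hb : b ∈ content q) : ⁅a, b⁆ ∈ content (p ++ q) :=
  sub_mem (mul_mem_content ha hb) (mul_mem_content' ha hb)

open Classical in
/-- The projection onto the span of the rearrangements of a monomial. -/
noncomputable def contentProj (p : List ι) : FreeAlgebra ℂ ι →ₗ[ℂ] FreeAlgebra ℂ ι :=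
  onWords fun l => if l.Perm p then word l else 0

theorem contentProj_of_mem {p : List ι} {a : FreeAlgebra ℂ ι} (ha : a ∈ content p) :
    contentProj p a = a :=
  eqOn_content (g := LinearMap.id) (fun l hl => by simp [contentProj, hl]) ha

theorem contentProj_word_of_not {p l : List ι} (h : ¬ l.Perm p) : contentProj p (word l) = 0 := by
  simp [contentProj, h]

theorem contentProj_of_mem_of_not {p q : List ι} {a : FreeAlgebra ℂ ι} (ha : a ∈ content q)
    (h : ¬ q.Perm p) : contentProj p a = 0 :=
  eqOn_content (g := 0) (fun l hl => by
    rw [contentProj_word_of_not fun h' => h (hl.symm.trans h')]; rfl) ha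

theorem ι_mem_content (i : ι) : FreeAlgebra.ι ℂ i ∈ content [i] :=
  word_singleton i ▸ word_mem_content (List.Perm.refl _)

theorem one_mem_content : (1 : FreeAlgebra ℂ ι) ∈ content [] := by
  rw [← word_nil]
  exact word_mem_content (List.Perm.refl [])

theorem symProd_mem_content {p q : List ι} {a b : FreeAlgebra ℂ ι} (ha : a ∈ content p)
    (hb : b ∈ content q) : symProd a b ∈ content (p ++ q) := by
  unfold symProd
  exact Submodule.smul_mem _ _ (add_mem (mul_mem_content ha hb) (mul_mem_content' ha hb))

theorem halfComm_mem_content {p q : List ι} {a b : FreeAlgebra ℂ ι} (ha : a ∈ content p)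
    (hb : b ∈ content q) : halfComm a b ∈ content (p ++ q) := by
  unfold halfComm
  exact Submodule.smul_mem _ _ (lie_mem_content ha hb)

theorem symWord_mem_content (l : List ι) : symWord (FreeAlgebra.ι ℂ) l ∈ content l := by
  induction l with
  | nil =>
    have h : symWord (FreeAlgebra.ι ℂ) ([] : List ι) = 1 := symWord_nil _
    rw [h]
    exact one_mem_content
  | cons i l ih =>
    have h := symProd_mem_content (ι_mem_content i) ih
    rwa [← symWord_cons] at h

theorem altWord_mem_content (l : List ι) : altWord (FreeAlgebra.ι ℂ) l ∈ content l ∧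
    ∀ i, altWordFrom (FreeAlgebra.ι ℂ) i l ∈ content (i :: l) := by
  induction l with
  | nil =>
    refine ⟨?_, fun i => ?_⟩
    · have h : altWord (FreeAlgebra.ι ℂ) ([] : List ι) = 1 := altWord_nil _
      rw [h]
      exact one_mem_content
    · rw [altWordFrom_nil]
      exact zero_mem _
  | cons j l ih =>
    refine ⟨by rw [altWord_cons]; exact ih.2 j, fun i => ?_⟩
    have h := mul_mem_content (halfComm_mem_content (ι_mem_content i) (ι_mem_content j)) ih.1
    rwa [← altWordFrom_cons] at h

end Words

section SignFunctionals

variable {ι : Type*}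

theorem eqOn_content₂ {V : Type*} [AddCommGroup V] [Module ℂ V]
    {f g : FreeAlgebra ℂ ι →ₗ[ℂ] FreeAlgebra ℂ ι →ₗ[ℂ] V} {p q : List ι}
    (h : ∀ u v, u.Perm p → v.Perm q → f (word u) (word v) = g (word u) (word v))
    {a b : FreeAlgebra ℂ ι} (ha : a ∈ content p) (hb : b ∈ content q) : f a b = g a b :=
  eqOn_content (f := f.flip b) (g := g.flip b)
    (fun u hu => eqOn_content (f := f (word u)) (g := g (word u)) (fun v hv => h u v hu hv) hb) ha

variable [LinearOrder ι]

/-- The functional sending a monomial to the sign of its subword with letters in `S`. -/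
noncomputable def signFun (S : Finset ι) : FreeAlgebra ℂ ι →ₗ[ℂ] ℂ :=
  onWords fun l => wordSign (l.filter (· ∈ S))

/-- The functional sending a monomial to the sign of its subword with letters in `S`, weighted by
the position of `j` in this subword. -/
noncomputable def posFun (S : Finset ι) (j : ι) : FreeAlgebra ℂ ι →ₗ[ℂ] ℂ :=
  onWords fun l => wordSign (l.filter (· ∈ S)) * ((l.filter (· ∈ S)).idxOf j : ℂ)

theorem signFun_word (S : Finset ι) (l : List ι) :
    signFun S (word l) = wordSign (l.filter (· ∈ S)) := onWords_word _ _

theorem posFun_word (S : Finset ι) (j : ι) (l : List ι) :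
    posFun S j (word l) = wordSign (l.filter (· ∈ S)) * ((l.filter (· ∈ S)).idxOf j : ℂ) :=
  onWords_word _ _

variable {p q : List ι} {a b : FreeAlgebra ℂ ι}

theorem signFun_mul (S : Finset ι) (ha : a ∈ content p) (hb : b ∈ content q) :
    signFun S (a * b) =
      crossSign (p.filter (· ∈ S)) (q.filter (· ∈ S)) * signFun S a * signFun S b := by
  have := eqOn_content₂ (f := (LinearMap.mul ℂ _).compr₂ (signFun S))
    (g := crossSign (p.filter (· ∈ S)) (q.filter (· ∈ S)) •
      (LinearMap.mul ℂ ℂ).compl₁₂ (signFun S) (signFun S)) (fun u v hu hv => ?_) ha hb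
  · simpa [mul_assoc] using this
  · simp [← word_append, signFun_word, wordSign_append,
      crossSign_perm (hu.filter (· ∈ S)) (hv.filter (· ∈ S)), mul_assoc]

theorem signFun_lie (S : Finset ι) (ha : a ∈ content p) (hb : b ∈ content q) :
    signFun S ⁅a, b⁆ =
      (1 - (-1) ^ ((p.filter (· ∈ S)).length * (q.filter (· ∈ S)).length)) *
      (crossSign (p.filter (· ∈ S)) (q.filter (· ∈ S)) * signFun S a * signFun S b) := by
  rw [Ring.lie_def, map_sub, signFun_mul S ha hb, signFun_mul S hb ha,
    crossSign_comm (p.filter (· ∈ S))]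
  ring

theorem signFun_lie_lie (S : Finset ι) {r : List ι} {c : FreeAlgebra ℂ ι} (ha : a ∈ content p)
    (hb : b ∈ content q) (hc : c ∈ content r) : signFun S ⁅a, ⁅b, c⁆⁆ = 0 := by
  rw [signFun_lie S ha (lie_mem_content hb hc), signFun_lie S hb hc, List.filter_append,
    List.length_append]
  rcases Nat.even_or_odd (q.filter (· ∈ S)).length with h | h
  · simp [h.mul_right]
  rcases Nat.even_or_odd (r.filter (· ∈ S)).length with h' | h'
  · simp [h'.mul_left]
  simp [(h.add_odd h').mul_left]

theorem posFun_lie_left {S : Finset ι} {j : ι}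
    (hS : Odd ((p.filter (· ∈ S)).length + (q.filter (· ∈ S)).length)) (hjS : j ∈ S)
    (hp : j ∈ p) (hq : j ∉ q) (ha : a ∈ content p) (hb : b ∈ content q) :
    posFun S j ⁅a, b⁆ = -((q.filter (· ∈ S)).length : ℂ) *
      (crossSign (p.filter (· ∈ S)) (q.filter (· ∈ S)) * signFun S a * signFun S b) := by
  have := eqOn_content₂ (f := (LinearMap.mul ℂ (FreeAlgebra ℂ ι) -
      (LinearMap.mul ℂ (FreeAlgebra ℂ ι)).flip).compr₂ (posFun S j))
    (g := (-((q.filter (· ∈ S)).length : ℂ) * crossSign (p.filter (· ∈ S)) (q.filter (· ∈ S))) •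
      (LinearMap.mul ℂ ℂ).compl₁₂ (signFun S) (signFun S)) (fun u v hu hv => ?_) ha hb
  · simpa [mul_assoc, Ring.lie_def] using this
  · have he : Even ((p.filter (· ∈ S)).length * (q.filter (· ∈ S)).length) := by
      rcases Nat.even_or_odd (p.filter (· ∈ S)).length with h | h
      · exact h.mul_right _
      · exact (by simpa [Nat.odd_add, h] using hS : Even _).mul_left _
    have hju : j ∈ u.filter (· ∈ S) := by simpa [hjS] using hu.mem_iff.2 hp
    have hjv : j ∉ v.filter (· ∈ S) := fun h => hq (hv.mem_iff.1 (List.mem_filter.1 h).1)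
    simp only [LinearMap.compr₂_apply, LinearMap.sub_apply, LinearMap.mul_apply', map_sub,
      LinearMap.flip_apply, LinearMap.smul_apply, LinearMap.compl₁₂_apply, smul_eq_mul,
      ← word_append, posFun_word, List.filter_append, wordSign_append, List.idxOf_append,
      signFun_word, hju, hjv, if_true, if_false,
      crossSign_perm (hu.filter (· ∈ S)) (hv.filter (· ∈ S)),
      crossSign_perm (hv.filter (· ∈ S)) (hu.filter (· ∈ S)),
      (hv.filter (· ∈ S)).length_eq, Nat.cast_add]
    rw [crossSign_comm (p.filter (· ∈ S)), he.neg_one_pow]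
    ring

theorem posFun_lie_right {S : Finset ι} {j : ι}
    (hS : Odd ((p.filter (· ∈ S)).length + (q.filter (· ∈ S)).length)) (hjS : j ∈ S)
    (hp : j ∉ p) (hq : j ∈ q) (ha : a ∈ content p) (hb : b ∈ content q) :
    posFun S j ⁅a, b⁆ = ((p.filter (· ∈ S)).length : ℂ) *
      (crossSign (p.filter (· ∈ S)) (q.filter (· ∈ S)) * signFun S a * signFun S b) := by
  have he : Even ((p.filter (· ∈ S)).length * (q.filter (· ∈ S)).length) := by
    rcases Nat.even_or_odd (p.filter (· ∈ S)).length with h | h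
    · exact h.mul_right _
    · exact (by simpa [Nat.odd_add, h] using hS : Even _).mul_left _
  have : ⁅a, b⁆ = -⁅b, a⁆ := by simp [Ring.lie_def]
  rw [this, map_neg, posFun_lie_left (by rwa [add_comm]) hjS hq hp hb ha,
    crossSign_comm (p.filter (· ∈ S)),
    he.neg_one_pow]
  ring

end SignFunctionals

section SignSums

variable {ι : Type*} [LinearOrder ι]

/-- The product of the signs of the pairs formed by `t` and the elements of `S`. -/
noncomputable def setSign (t : ι) (S : Finset ι) : ℂ := ∏ u ∈ S, pairSign t u

theorem setSign_mul_self {t : ι} {S : Finset ι} (h : t ∉ S) : setSign t S * setSign t S = 1 := by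
  rw [setSign, ← Finset.prod_mul_distrib]
  exact Finset.prod_eq_one fun u hu => pairSign_mul_self fun e => h (e ▸ hu)

theorem crossOne_eq_setSign (t : ι) {l : List ι} (hl : l.Nodup) {S : Finset ι}
    (h : ∀ i, i ∈ l ↔ i ∈ S) : crossOne t l = setSign t S := by
  have : S = l.toFinset := by ext i; simp [h]
  rw [this, setSign, List.prod_toFinset _ hl, crossOne]

theorem sum_crossOne_mul_wordSign_erase {l : List ι} (hl : l.Nodup) :
    ∑ t ∈ l.toFinset, crossOne t (l.erase t) * wordSign (l.erase t) =
      if Odd l.length then wordSign l else 0 := by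
  induction l with
  | nil => simp
  | cons a l ih =>
    obtain ⟨ha, hl'⟩ := List.nodup_cons.1 hl
    have : ∀ t ∈ l.toFinset, crossOne t ((a :: l).erase t) * wordSign ((a :: l).erase t) =
        -crossOne a l * (crossOne t (l.erase t) * wordSign (l.erase t)) := by
      intro t ht
      have ht : t ∈ l := List.mem_toFinset.1 ht
      have hta : a ≠ t := fun h => ha (h ▸ ht)
      rw [List.erase_cons_tail (by simpa using hta), crossOne_perm a (List.perm_cons_erase ht)]
      simp only [crossOne_cons, wordSign_cons, pairSign_swap a t]
      ring
    rw [List.toFinset_cons, Finset.sum_insert (by simpa using ha), Finset.sum_congr rfl this,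
      ← Finset.mul_sum, ih hl', List.erase_cons_head]
    rcases Nat.even_or_odd l.length with h | h
    · have h' := Nat.not_odd_iff_even.2 h
      simp [h', h.add_one]
    · have h' : ¬ Odd (l.length + 1) := Nat.not_odd_iff_even.2 h.add_one
      simp [h, h']

theorem length_filter_mem {l : List ι} (hl : l.Nodup) {S : Finset ι} (hS : ∀ i ∈ S, i ∈ l) :
    (l.filter (· ∈ S)).length = S.card := by
  rw [← List.toFinset_card_of_nodup (hl.filter _)]
  congr 1; ext i; simpa using hS i

theorem sum_setSign_mul_wordSign {l : List ι} (hl : l.Nodup) {T : Finset ι} (hT : ∀ i ∈ T, i ∈ l)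
    (he : Even T.card) :
    ∑ t ∈ T, setSign t (T.erase t) * wordSign (l.filter (· ∈ T.erase t)) = 0 := by
  have := sum_crossOne_mul_wordSign_erase (hl.filter (· ∈ T))
  rw [length_filter_mem hl hT, if_neg (Nat.not_odd_iff_even.2 he)] at this
  rw [← this]
  refine Finset.sum_congr (by ext i; simpa using hT i) fun t ht => ?_
  have h : (l.filter (· ∈ T)).erase t = l.filter (· ∈ T.erase t) := by
    rw [(hl.filter _).erase_eq_filter, List.filter_filter]
    exact List.filter_congr fun x _ => by
      by_cases hx : x = t <;> simp [hx]
  rw [h, crossOne_eq_setSign (S := T.erase t) t (hl.filter _)]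
  intro i
  simp only [List.mem_filter, Finset.mem_erase, decide_eq_true_eq]
  exact ⟨fun h => h.2, fun h => ⟨hT _ h.2, h⟩⟩

variable {l₀ : List ι} (hl₀ : l₀.Nodup) (hmem : ∀ i, i ∈ l₀) {i : ι} {m : List ι}
  (hm : (i :: m).Perm l₀)

include hl₀ hmem hm

theorem posFun_lie_letter {S : Finset ι} (hS : Odd S.card) {j : ι} (hj : j ∈ S) :
    posFun S j ⁅word [i], word m⁆ =
      if i ∈ S then (1 - if i = j then (S.card : ℂ) else 0) * wordSign ((i :: m).filter (· ∈ S))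
      else 0 := by
  have hn : (i :: m).Nodup := hm.nodup_iff.2 hl₀
  obtain ⟨him, -⟩ := List.nodup_cons.1 hn
  have hc := length_filter_mem hn (S := S) fun i _ => hm.mem_iff.2 (hmem i)
  have hc' : (([i] : List ι).filter (· ∈ S)).length + (m.filter (· ∈ S)).length = S.card := by
    rw [← List.length_append, ← List.filter_append]; exact hc
  have hi := word_mem_content (List.Perm.refl [i])
  have hw := word_mem_content (List.Perm.refl m)
  have hs := wordSign_append (([i] : List ι).filter (· ∈ S)) (m.filter (· ∈ S))
  rw [← List.filter_append, List.singleton_append] at hs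
  by_cases hij : i = j
  · subst hij
    rw [posFun_lie_left (hc' ▸ hS) hj (by simp) him hi hw, if_pos hj, if_pos rfl, signFun_word,
      signFun_word, hs, ← hc']
    simp [hj]
  · have hjm : j ∈ m := by
      have := hm.mem_iff.2 (hmem j)
      simpa [Ne.symm hij] using this
    rw [posFun_lie_right (hc' ▸ hS) hj (by simpa using Ne.symm hij) hjm hi hw, signFun_word,
      signFun_word, hs, if_neg hij]
    by_cases h : i ∈ S <;> simp [h]

theorem signFun_lie_letter {T : Finset ι} (hT : Even T.card) :
    signFun T ⁅word [i], word m⁆ =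
      if i ∈ T then -2 * ∑ t ∈ T.erase i,
        setSign t (T.erase t) * wordSign ((i :: m).filter (· ∈ T.erase t)) else 0 := by
  have hn : (i :: m).Nodup := hm.nodup_iff.2 hl₀
  obtain ⟨him, -⟩ := List.nodup_cons.1 hn
  have hc := length_filter_mem hn (S := T) fun i _ => hm.mem_iff.2 (hmem i)
  have hi := word_mem_content (List.Perm.refl [i])
  have hw := word_mem_content (List.Perm.refl m)
  rw [signFun_lie _ hi hw, signFun_word, signFun_word]
  by_cases h : i ∈ T
  · have hs := sum_setSign_mul_wordSign hn (fun i _ => hm.mem_iff.2 (hmem i)) hT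
    have h2 : (i :: m).filter (· ∈ T.erase i) = m.filter (· ∈ T) := by
      rw [List.filter_cons_of_neg (by simp)]
      refine List.filter_congr fun x hx => ?_
      have : x ≠ i := fun e => him (e ▸ hx)
      simp [this]
    have h3 : ∀ j, j ∈ m.filter (· ∈ T) ↔ j ∈ T.erase i := by
      intro j
      rw [← h2]
      simp only [List.mem_filter, decide_eq_true_eq, and_iff_right_iff_imp]
      exact fun _ => hm.mem_iff.2 (hmem j)
    have hodd : Odd (m.filter (· ∈ T)).length := by
      rw [List.filter_cons_of_pos (by simpa using h), List.length_cons] at hc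
      rw [← hc, Nat.even_add_one, Nat.not_even_iff_odd] at hT
      exact hT
    rw [← Finset.add_sum_erase _ _ h, h2] at hs
    rw [if_pos h, ← neg_eq_iff_add_eq_zero.2 hs]
    simp only [h, List.filter_cons_of_pos, decide_true, List.filter_nil, List.length_singleton,
      one_mul, hodd.neg_one_pow, crossSign_cons, crossSign_nil, wordSign_cons, wordSign_nil,
      crossOne_nil, crossOne_eq_setSign i ((List.nodup_cons.1 hn).2.filter _) h3]
    ring
  · simp [h]

end SignSums

section Correction

theorem exists_coefficients {ι : Type*} [Fintype ι] [DecidableEq ι] (o : ι) (β : Finset ι → ι)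
    (hβo : ∀ S, o ∈ S → β S = o) (ε : ι → Finset ι → ℂ)
    (hε : ∀ t S, t ∉ S → ε t S * ε t S = 1) (H : Finset ι → ι → ℂ) :
    ∃ (c : Finset ι → ι → ℂ) (E : Finset ι → ℂ), (∀ S, c S (β S) = 0) ∧
      ∀ S, Odd S.card → ∀ i ∈ S, i ≠ o →
        H S i + 2 * ∑ t ∈ Finset.univ.filter (fun t => t ∉ S ∧ o ∈ insert t S),
          E (insert t S) * ε t S = ∑ j ∈ S, c S j - S.card * c S i := by
  let cout (S : Finset ι) (i : ι) : ℂ := (H S (β S) - H S i) / S.card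
  let E (T : Finset ι) : ℂ :=
    (∑ j ∈ T.erase o, cout (T.erase o) j - H (T.erase o) (β (T.erase o))) * ε o (T.erase o) / 2
  let H' (S : Finset ι) (i : ι) : ℂ :=
    H S i + 2 * ∑ t ∈ Finset.univ.filter (fun t => t ∉ S ∧ o ∈ insert t S), E (insert t S) * ε t S
  let c (S : Finset ι) (i : ι) : ℂ := if o ∈ S then
      (if i = o then 0 else (-∑ k ∈ S.erase o, H' S k - H' S i) / S.card)
    else cout S i
  refine ⟨c, E, fun S => ?_, fun S hS i hi hio => ?_⟩
  · by_cases h : o ∈ S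
    · simp [c, h, hβo S h]
    · simp [c, h, cout]
  · have hS0 : (S.card : ℂ) ≠ 0 := by
      have := hS.pos
      exact_mod_cast this.ne'
    by_cases h : o ∈ S
    · have hc (k : ι) : c S k = if k = o then 0 else
          (-∑ k ∈ S.erase o, H' S k - H' S k) / S.card := by simp only [c, if_pos h]
      have hsum : ∑ j ∈ S, c S j = -∑ k ∈ S.erase o, H' S k := by
        rw [← Finset.add_sum_erase _ _ h, hc o, if_pos rfl, zero_add,
          Finset.sum_congr rfl fun k hk => by rw [hc k, if_neg (Finset.ne_of_mem_erase hk)],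
          ← Finset.sum_div, Finset.sum_sub_distrib, Finset.sum_const, Finset.card_erase_of_mem h,
          nsmul_eq_mul, Nat.cast_sub hS.pos, Nat.cast_one]
        field_simp
        ring
      change H' S i = _
      rw [hsum, hc i, if_neg hio]
      field_simp
      ring
    · have hc (k : ι) : c S k = cout S k := by simp only [c, if_neg h]
      have hfil : Finset.univ.filter (fun t => t ∉ S ∧ o ∈ insert t S) = {o} := by
        ext t
        simp only [Finset.mem_filter, Finset.mem_univ, true_and, Finset.mem_insert,
          Finset.mem_singleton, h, or_false]
        exact ⟨fun h' => h'.2.symm, fun h' => ⟨h' ▸ h, h'.symm⟩⟩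
      rw [hfil, Finset.sum_singleton]
      simp only [E, Finset.erase_insert h, hc]
      have : (∑ j ∈ S, cout S j - H S (β S)) * ε o S / 2 * ε o S =
          (∑ j ∈ S, cout S j - H S (β S)) / 2 := by
        linear_combination ((∑ j ∈ S, cout S j - H S (β S)) / 2) * hε o S h
      rw [this]
      simp only [cout]
      field_simp
      ring

variable {ι : Type*} [LinearOrder ι] [Fintype ι] {l₀ : List ι} (hl₀ : l₀.Nodup)
  (hmem : ∀ i, i ∈ l₀)

include hl₀ hmem

theorem exists_apply_lie_letter {f : FreeAlgebra ℂ ι →ₗ[ℂ] ℂ}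
    (hf : ∀ a b c d : FreeAlgebra ℂ ι, f ⁅a, ⁅b, ⁅c, d⁆⁆⁆ = 0) :
    ∃ H : Finset ι → ι → ℂ, ∀ i m, (i :: m).Perm l₀ → f ⁅word [i], word m⁆ =
      ∑ S ∈ Finset.univ.filter (fun S : Finset ι => Odd S.card ∧ i ∈ S),
        H S i * wordSign ((i :: m).filter (· ∈ S)) := by
  have key (i : ι) := exists_apply_word_eq_sum
    (g := f ∘ₗ (LinearMap.mulLeft ℂ (word [i]) - LinearMap.mulRight ℂ (word [i])))
    (fun p q a b c => apply_lie_mul_lie_mul_eq_zero hf (word [i]) p q a b c)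
    (FreeAlgebra.ι ℂ) (l₀.erase i) (hl₀.erase i)
  choose h hodd hsum using key
  refine ⟨fun S i => h i (S.erase i) * setSign i (S.erase i), fun i m hm => ?_⟩
  have hn : (i :: m).Nodup := hm.nodup_iff.2 hl₀
  obtain ⟨him, hnm⟩ := List.nodup_cons.1 hn
  have hmm : ∀ j, j ≠ i → j ∈ m := fun j hj => by
    simpa [hj] using hm.mem_iff.2 (hmem j)
  have hper : m.Perm (l₀.erase i) := by simpa using hm.erase i
  have hT : ∀ T, T ∈ (l₀.erase i).toFinset.powerset ↔ i ∉ T := fun T => by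
    rw [Finset.mem_powerset]
    refine ⟨fun h hi => ?_, fun h j hj => List.mem_toFinset.2 (hper.mem_iff.1 (hmm j ?_))⟩
    · exact him (hper.mem_iff.2 (List.mem_toFinset.1 (h hi)))
    · exact fun e => h (e ▸ hj)
  have := hsum i m hper
  rw [← Finset.sum_filter_of_ne (p := fun T : Finset ι => Even T.card)] at this
  · refine (show f ⁅word [i], word m⁆ = _ from this).trans ?_
    refine Finset.sum_nbij' (insert i) (Finset.erase · i) ?_ ?_ ?_ ?_ ?_
    · intro T h
      obtain ⟨h1, h2⟩ := Finset.mem_filter.1 h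
      rw [hT] at h1
      simp [h1, h2.add_one]
    · intro S h
      obtain ⟨-, h1, h2⟩ := Finset.mem_filter.1 h
      rw [Finset.mem_filter, hT, Finset.card_erase_of_mem h2]
      exact ⟨by simp, Nat.Odd.sub_odd h1 odd_one⟩
    · intro T h
      exact Finset.erase_insert ((hT T).1 (Finset.mem_filter.1 h).1)
    · intro S h
      exact Finset.insert_erase (Finset.mem_filter.1 h).2.2
    · intro T hTm
      have hiT := (hT T).1 (Finset.mem_filter.1 hTm).1
      have hfm : m.filter (· ∈ insert i T) = m.filter (· ∈ T) :=
        List.filter_congr fun x hx => by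
          have : x ≠ i := fun e => him (e ▸ hx)
          simp [this]
      beta_reduce
      rw [List.filter_cons_of_pos (by simp), hfm, Finset.erase_insert hiT, wordSign_cons,
        crossOne_eq_setSign (S := T) i (hnm.filter _)]
      · linear_combination -(h i T * wordSign (m.filter (· ∈ T))) * setSign_mul_self hiT
      · intro j
        simp only [List.mem_filter, decide_eq_true_eq, and_iff_right_iff_imp]
        exact fun hj => hmm j fun e => hiT (e ▸ hj)
  · intro T hT' hne
    by_contra hne'
    exact hne (by rw [hodd i T (Finset.mem_powerset.1 hT') (Nat.not_even_iff_odd.1 hne'), mul_zero])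

theorem exists_apply_lie_letter_eq {f : FreeAlgebra ℂ ι →ₗ[ℂ] ℂ}
    (hf : ∀ a b c d : FreeAlgebra ℂ ι, f ⁅a, ⁅b, ⁅c, d⁆⁆⁆ = 0) (o : ι) (β : Finset ι → ι)
    (hβo : ∀ S, o ∈ S → β S = o) :
    ∃ (c : Finset ι → ι → ℂ) (E : Finset ι → ℂ), (∀ S, c S (β S) = 0) ∧
      ∀ i m, i ≠ o → (i :: m).Perm l₀ → f ⁅word [i], word m⁆ =
        (∑ S ∈ Finset.univ.filter (fun S : Finset ι => Odd S.card), ∑ j ∈ S,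
            c S j • posFun S j +
          ∑ T ∈ Finset.univ.filter (fun T : Finset ι => Even T.card ∧ o ∈ T),
            E T • signFun T) ⁅word [i], word m⁆ := by
  obtain ⟨H, hH⟩ := exists_apply_lie_letter hl₀ hmem hf
  obtain ⟨c, E, hc, hE⟩ := exists_coefficients o β hβo setSign (fun t S => setSign_mul_self) H
  refine ⟨c, E, hc, fun i m hio hm => ?_⟩
  simp only [LinearMap.add_apply, LinearMap.sum_apply, LinearMap.smul_apply, smul_eq_mul]
  have h1 : ∑ S ∈ Finset.univ.filter (fun S : Finset ι => Odd S.card),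
      ∑ j ∈ S, c S j * posFun S j ⁅word [i], word m⁆ =
      ∑ S ∈ Finset.univ.filter (fun S : Finset ι => Odd S.card ∧ i ∈ S),
        (∑ j ∈ S, c S j - S.card * c S i) * wordSign ((i :: m).filter (· ∈ S)) := by
    rw [← Finset.filter_filter, Finset.sum_filter (p := fun S : Finset ι => i ∈ S)]
    refine Finset.sum_congr rfl fun S hS => ?_
    have hS := (Finset.mem_filter.1 hS).2
    rw [Finset.sum_congr rfl fun j hj => by rw [posFun_lie_letter hl₀ hmem hm hS hj]]
    split_ifs with hi
    · simp only [sub_mul, mul_sub, Finset.sum_sub_distrib, Finset.sum_mul, one_mul, ite_mul,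
        mul_ite, zero_mul, mul_zero, Finset.sum_ite_eq, hi, if_true]
      ring
    · simp
  have h2 : ∑ T ∈ Finset.univ.filter (fun T : Finset ι => Even T.card ∧ o ∈ T),
      E T * signFun T ⁅word [i], word m⁆ =
      -∑ S ∈ Finset.univ.filter (fun S : Finset ι => Odd S.card ∧ i ∈ S),
        (2 * ∑ t ∈ Finset.univ.filter (fun t => t ∉ S ∧ o ∈ insert t S),
          E (insert t S) * setSign t S) * wordSign ((i :: m).filter (· ∈ S)) := by
    have h3 : ∀ T ∈ Finset.univ.filter (fun T : Finset ι => Even T.card ∧ o ∈ T),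
        E T * signFun T ⁅word [i], word m⁆ = if i ∈ T then ∑ t ∈ T.erase i, -2 * (E T *
          (setSign t (T.erase t) * wordSign ((i :: m).filter (· ∈ T.erase t)))) else 0 := by
      intro T hT
      rw [signFun_lie_letter hl₀ hmem hm (Finset.mem_filter.1 hT).2.1, ← Finset.mul_sum,
        ← Finset.mul_sum]
      split_ifs
      · ring
      · simp
    rw [Finset.sum_congr rfl h3, ← Finset.sum_filter, ← Finset.sum_neg_distrib]
    simp only [Finset.mul_sum, Finset.sum_mul, ← Finset.sum_neg_distrib]
    rw [Finset.sum_sigma', Finset.sum_sigma']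
    refine Finset.sum_nbij' (fun x => ⟨x.1.erase x.2, x.2⟩) (fun x => ⟨insert x.2 x.1, x.2⟩)
      ?_ ?_ ?_ ?_ ?_
    · rintro ⟨T, t⟩ h
      simp only [Finset.mem_sigma, Finset.mem_filter, Finset.mem_univ, true_and,
        Finset.mem_erase] at h ⊢
      obtain ⟨⟨⟨h1, h2⟩, h3⟩, h4, h5⟩ := h
      rw [Finset.card_erase_of_mem h5, Finset.insert_erase h5]
      have := Finset.card_pos.2 ⟨t, h5⟩
      exact ⟨⟨by rw [Nat.odd_sub (by omega)]; simpa using h1, Ne.symm h4, h3⟩, by simp, h2⟩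
    · rintro ⟨S, t⟩ h
      simp only [Finset.mem_sigma, Finset.mem_filter, Finset.mem_univ, true_and,
        Finset.mem_erase] at h ⊢
      obtain ⟨⟨h1, h2⟩, h3, h4⟩ := h
      rw [Finset.card_insert_of_notMem h3]
      exact ⟨⟨⟨h1.add_one, h4⟩, Finset.mem_insert_of_mem h2⟩, fun e => h3 (e ▸ h2), by simp⟩
    · rintro ⟨T, t⟩ h
      simp only [Finset.mem_sigma, Finset.mem_erase] at h
      simp [Finset.insert_erase h.2.2]
    · rintro ⟨S, t⟩ h
      simp only [Finset.mem_sigma, Finset.mem_filter] at h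
      simp [Finset.erase_insert h.2.2.1]
    · rintro ⟨T, t⟩ h
      simp only [Finset.mem_sigma, Finset.mem_erase] at h
      simp only [Finset.insert_erase h.2.2]
      ring
  rw [h1, h2, hH i m hm, ← sub_eq_add_neg, ← Finset.sum_sub_distrib]
  refine Finset.sum_congr rfl fun S hS => ?_
  obtain ⟨-, hS, hi⟩ := Finset.mem_filter.1 hS
  rw [← sub_mul, ← hE S hS i hi hio]
  ring

end Correction

section LowerCentralSeries

variable {n : ℕ}

theorem lie_mem_lcs {m : ℕ} (a : FreeAlgebra ℂ (Fin n)) {w : FreeAlgebra ℂ (Fin n)}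
    (hw : w ∈ lcs n (m + 1)) : ⁅a, w⁆ ∈ lcs n (m + 2) := by
  rw [lcs]
  exact Submodule.subset_span ⟨a, w, hw, rfl⟩

theorem lcs_three_le : lcs n 3 ≤ lcs n 2 := by
  rw [lcs, Submodule.span_le]
  rintro _ ⟨a, w, -, rfl⟩
  exact lie_mem_lcs a (show w ∈ lcs n 1 by rw [lcs]; trivial)

/-- The inner derivation `w ↦ [a, w]`. -/
noncomputable def innerDer (a : FreeAlgebra ℂ (Fin n)) :
    FreeAlgebra ℂ (Fin n) →ₗ[ℂ] FreeAlgebra ℂ (Fin n) :=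
  LinearMap.mulLeft ℂ a - LinearMap.mulRight ℂ a

theorem innerDer_apply (a w : FreeAlgebra ℂ (Fin n)) : innerDer a w = ⁅a, w⁆ := rfl

variable {V : Type*} [AddCommGroup V] [Module ℂ V]

theorem lcs_one_le_ker (g : FreeAlgebra ℂ (Fin n) →ₗ[ℂ] V) (h : ∀ u, g (word u) = 0) :
    lcs n 1 ≤ LinearMap.ker g := by
  rw [eq_of_word (g := 0) h, LinearMap.ker_zero]
  exact le_top

theorem lcs_le_ker {m : ℕ} (g : FreeAlgebra ℂ (Fin n) →ₗ[ℂ] V)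
    (h : ∀ u, lcs n (m + 1) ≤ LinearMap.ker (g ∘ₗ innerDer (word u))) :
    lcs n (m + 2) ≤ LinearMap.ker g := by
  rw [lcs, Submodule.span_le]
  rintro _ ⟨a, w, hw, rfl⟩
  have : g ∘ₗ (LinearMap.mulRight ℂ w - LinearMap.mulLeft ℂ w) = 0 :=
    eq_of_word fun u => h u hw
  exact LinearMap.congr_fun this a

theorem apply_eq_zero_of_mem_lcs_two {p : List (Fin n)} {g : FreeAlgebra ℂ (Fin n) →ₗ[ℂ] V}
    (h : ∀ u v, (u ++ v).Perm p → g ⁅word u, word v⁆ = 0) {x : FreeAlgebra ℂ (Fin n)}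
    (hx : x ∈ lcs n 2) (hp : x ∈ content p) : g x = 0 := by
  rw [← contentProj_of_mem hp, ← LinearMap.comp_apply]
  refine lcs_le_ker _ (fun u => lcs_one_le_ker _ fun v => ?_) hx
  have hw (l : List (Fin n)) := word_mem_content (List.Perm.refl l)
  have hm := lie_mem_content (hw u) (hw v)
  rw [LinearMap.comp_apply, LinearMap.comp_apply, innerDer_apply]
  by_cases hc : (u ++ v).Perm p
  · rw [contentProj_of_mem (content_congr hc ▸ hm), h u v hc]
  · rw [contentProj_of_mem_of_not hm hc, map_zero]

theorem apply_eq_zero_of_mem_lcs_four {p : List (Fin n)} {g : FreeAlgebra ℂ (Fin n) →ₗ[ℂ] V}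
    (h : ∀ u v w z, (u ++ (v ++ (w ++ z))).Perm p → g ⁅word u, ⁅word v, ⁅word w, word z⁆⁆⁆ = 0)
    {x : FreeAlgebra ℂ (Fin n)} (hx : x ∈ lcs n 4) (hp : x ∈ content p) : g x = 0 := by
  rw [← contentProj_of_mem hp, ← LinearMap.comp_apply]
  refine lcs_le_ker _ (fun u => lcs_le_ker _ fun v => lcs_le_ker _ fun w =>
    lcs_one_le_ker _ fun z => ?_) hx
  have hw (l : List (Fin n)) := word_mem_content (List.Perm.refl l)
  have hm := lie_mem_content (hw u) (lie_mem_content (hw v) (lie_mem_content (hw w) (hw z)))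
  simp only [LinearMap.comp_apply, innerDer_apply]
  by_cases hc : (u ++ (v ++ (w ++ z))).Perm p
  · rw [contentProj_of_mem (content_congr hc ▸ hm), h u v w z hc]
  · rw [contentProj_of_mem_of_not hm hc, map_zero]

theorem signFun_eq_zero_of_mem_lcs (S : Finset (Fin n)) {x : FreeAlgebra ℂ (Fin n)}
    (hx : x ∈ lcs n 3) : signFun S x = 0 := by
  refine lcs_le_ker (signFun S) (fun u => lcs_le_ker _ fun v => lcs_one_le_ker _ fun w => ?_) hx
  have hw (l : List (Fin n)) := word_mem_content (List.Perm.refl l)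
  exact signFun_lie_lie S (hw u) (hw v) (hw w)

variable {l₀ : List (Fin n)} (hl₀ : l₀.Nodup) (hmem : ∀ i, i ∈ l₀)

include hl₀ hmem

theorem posFun_eq_zero_of_mem_lcs {S : Finset (Fin n)} (hS : Odd S.card) {j : Fin n} (hj : j ∈ S)
    {x : FreeAlgebra ℂ (Fin n)} (hx : x ∈ lcs n 4) (hp : x ∈ content l₀) : posFun S j x = 0 := by
  refine apply_eq_zero_of_mem_lcs_four (fun u v w z hc => ?_) hx hp
  have hw (l : List (Fin n)) := word_mem_content (List.Perm.refl l)
  have hm := lie_mem_content (hw v) (lie_mem_content (hw w) (hw z))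
  have h0 := signFun_lie_lie S (hw v) (hw w) (hw z)
  have hn := hc.nodup_iff.2 hl₀
  have hlen := length_filter_mem hn (S := S) fun i _ => hc.mem_iff.2 (hmem i)
  rw [List.filter_append, List.length_append] at hlen
  have hd := List.disjoint_of_nodup_append hn
  rcases List.mem_append.1 (hc.mem_iff.2 (hmem j)) with hju | hju
  · rw [posFun_lie_left (hlen ▸ hS) hj hju (hd hju) (hw u) hm, h0, mul_zero, mul_zero]
  · rw [posFun_lie_right (hlen ▸ hS) hj (fun h => hd h hju) hju (hw u) hm, h0, mul_zero, mul_zero]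

theorem mem_lcs_four (o : Fin n) (β : Finset (Fin n) → Fin n) (hβo : ∀ S, o ∈ S → β S = o)
    {x : FreeAlgebra ℂ (Fin n)} (hx : x ∈ lcs n 3) (hp : x ∈ content l₀)
    (h : ∀ S, Odd S.card → ∀ j ∈ S, j ≠ β S → posFun S j x = 0) : x ∈ lcs n 4 := by
  by_contra hx4
  obtain ⟨f, hfx, hf⟩ := Submodule.exists_le_ker_of_notMem hx4
  obtain ⟨c, E, hc, hfe⟩ := exists_apply_lie_letter_eq hl₀ hmem (f := f) (fun a b c d =>
    hf (lie_mem_lcs a (lie_mem_lcs b (lie_mem_lcs c (show d ∈ lcs n 1 by rw [lcs]; trivial)))))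
    o β hβo
  generalize hφ : (∑ S ∈ Finset.univ.filter (fun S : Finset (Fin n) => Odd S.card),
    ∑ j ∈ S, c S j • posFun S j + ∑ T ∈ Finset.univ.filter
      (fun T : Finset (Fin n) => Even T.card ∧ o ∈ T), E T • signFun T) = φ at hfe
  have hφx : φ x = 0 := by
    simp only [← hφ, LinearMap.add_apply, LinearMap.sum_apply, LinearMap.smul_apply, smul_eq_mul,
      signFun_eq_zero_of_mem_lcs _ hx, mul_zero, Finset.sum_const_zero, add_zero]
    refine Finset.sum_eq_zero fun S hS => Finset.sum_eq_zero fun j hj => ?_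
    by_cases hjβ : j = β S
    · rw [hjβ, hc, zero_mul]
    · rw [h S (Finset.mem_filter.1 hS).2 j hj hjβ, mul_zero]
  have hu : ∀ u v, o ∉ u → (u ++ v).Perm l₀ → (f - φ) ⁅word u, word v⁆ = 0 := by
    intro u
    induction u with
    | nil => intro v _ _; simp [Ring.lie_def]
    | cons i u ih =>
      intro v ho huv
      have h1 : ⁅word (i :: u), word v⁆ = ⁅word [i], word (u ++ v)⁆ + ⁅word u, word (v ++ [i])⁆ := by
        simp only [Ring.lie_def, word_cons i u, word_append]
        noncomm_ring
      rw [h1, map_add, ih _ (fun h => ho (List.mem_cons_of_mem _ h)), add_zero,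
        LinearMap.sub_apply, hfe i (u ++ v) (fun h => ho (h ▸ List.mem_cons_self)) huv, sub_self]
      refine List.Perm.trans ?_ huv
      rw [← List.append_assoc]
      exact List.perm_append_singleton i _
  have : (f - φ) x = 0 := by
    refine apply_eq_zero_of_mem_lcs_two (fun u v huv => ?_) (lcs_three_le hx) hp
    by_cases ho : o ∈ u
    · have hd := List.disjoint_of_nodup_append (huv.nodup_iff.2 hl₀)
      have h1 : ⁅word u, word v⁆ = -⁅word v, word u⁆ := by simp [Ring.lie_def]
      rw [h1, map_neg, hu v u (hd ho) (List.perm_append_comm.trans huv), neg_zero]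
    · exact hu u v ho huv
  rw [LinearMap.sub_apply, hφx, sub_zero] at this
  exact hfx this

end LowerCentralSeries

section Values

variable {ι : Type*} [LinearOrder ι] {p q : List ι} {a b : FreeAlgebra ℂ ι}

theorem signFun_symProd (S : Finset ι) (ha : a ∈ content p) (hb : b ∈ content q) :
    signFun S (symProd a b) =
      (1 + (-1) ^ ((p.filter (· ∈ S)).length * (q.filter (· ∈ S)).length)) / 2 *
      (crossSign (p.filter (· ∈ S)) (q.filter (· ∈ S)) * signFun S a * signFun S b) := by
  unfold symProd
  rw [map_smul, map_add, signFun_mul S ha hb, signFun_mul S hb ha,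
    crossSign_comm (p.filter (· ∈ S)), smul_eq_mul]
  ring

theorem signFun_halfComm (S : Finset ι) (ha : a ∈ content p) (hb : b ∈ content q) :
    signFun S (halfComm a b) =
      (1 - (-1) ^ ((p.filter (· ∈ S)).length * (q.filter (· ∈ S)).length)) / 2 *
      (crossSign (p.filter (· ∈ S)) (q.filter (· ∈ S)) * signFun S a * signFun S b) := by
  unfold halfComm
  rw [map_smul, ← Ring.lie_def, signFun_lie S ha hb, smul_eq_mul]
  ring

theorem signFun_letter (S : Finset ι) (i : ι) : signFun S (FreeAlgebra.ι ℂ i) = 1 := by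
  rw [← word_singleton, signFun_word]
  by_cases h : i ∈ S <;> simp [h]

theorem signFun_one (S : Finset ι) : signFun S 1 = 1 := by
  rw [← word_nil, signFun_word]
  simp

theorem signFun_symWord (S : Finset ι) (l : List ι) :
    signFun S (symWord (FreeAlgebra.ι ℂ) l) =
      if (l.filter (· ∈ S)).length ≤ 1 then 1 else 0 := by
  induction l with
  | nil => simpa using signFun_one S
  | cons i l ih =>
    rw [symWord_cons, signFun_symProd S (ι_mem_content i) (symWord_mem_content l), signFun_letter,
      ih]
    by_cases h : i ∈ S
    · simp only [h, List.filter_cons_of_pos, decide_true, List.filter_nil, List.length_cons]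
      rcases hl : l.filter (· ∈ S) with _ | ⟨k, _ | ⟨k', r⟩⟩ <;> norm_num
    · simp [h]

theorem signFun_altWord (S : Finset ι) (l : List ι) :
    (Even l.length → signFun S (altWord (FreeAlgebra.ι ℂ) l) =
      if ∀ k ∈ l, k ∈ S then wordSign l else 0) ∧
    ∀ i, Odd l.length → signFun S (altWordFrom (FreeAlgebra.ι ℂ) i l) =
      if ∀ k ∈ i :: l, k ∈ S then wordSign (i :: l) else 0 := by
  induction l with
  | nil => exact ⟨fun _ => by simpa using signFun_one S, fun i h => by simp at h⟩
  | cons j l ih =>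
    refine ⟨fun h => ?_, fun i h => ?_⟩
    · rw [altWord_cons]
      exact ih.2 j (by simpa [Nat.even_add_one] using h)
    · rw [altWordFrom_cons, signFun_mul S (halfComm_mem_content (ι_mem_content i)
        (ι_mem_content j)) (altWord_mem_content l).1,
        signFun_halfComm S (ι_mem_content i) (ι_mem_content j), signFun_letter, signFun_letter,
        ih.1 (by simpa [Nat.odd_add_one] using h)]
      by_cases hi : i ∈ S
      · by_cases hj : j ∈ S
        · by_cases hl : ∀ k ∈ l, k ∈ S
          · have : l.filter (· ∈ S) = l := List.filter_eq_self.2 (by simpa using hl)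
            simp [hi, hj, this]
            rw [if_pos hl, if_pos hl]
            ring
          · simp [hi, hj]
            rw [if_neg hl, if_neg hl]
        · simp [hj]
      · simp [hi]

theorem posFun_lie {S : Finset ι} {j : ι} (hn : (p ++ q).Nodup) (hj : j ∈ S) (hjpq : j ∈ p ++ q)
    (hS : Odd ((p.filter (· ∈ S)).length + (q.filter (· ∈ S)).length))
    (ha : a ∈ content p) (hb : b ∈ content q) :
    posFun S j ⁅a, b⁆ =
      (if j ∈ p then -((q.filter (· ∈ S)).length : ℂ) else ((p.filter (· ∈ S)).length : ℂ)) *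
      (crossSign (p.filter (· ∈ S)) (q.filter (· ∈ S)) * signFun S a * signFun S b) := by
  have hd := List.disjoint_of_nodup_append hn
  rcases List.mem_append.1 hjpq with h | h
  · rw [posFun_lie_left hS hj h (hd h) ha hb, if_pos h]
  · have h' : j ∉ p := fun h' => hd h' h
    rw [posFun_lie_right hS hj h' h ha hb, if_neg h']

end Values

section DualElements

variable {ι : Type*}

/-- The commutator `[X(p), [X(q), w · Y(t)]]` of symmetrised words `X` and an alternating
word `Y`. -/
noncomputable def symLie (p q : List ι) (w : ι) (t : List ι) : FreeAlgebra ℂ ι :=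
  ⁅symWord (FreeAlgebra.ι ℂ) p, ⁅symWord (FreeAlgebra.ι ℂ) q,
    FreeAlgebra.ι ℂ w * altWord (FreeAlgebra.ι ℂ) t⁆⁆

theorem letter_mul_altWord_mem_content (w : ι) (t : List ι) :
    FreeAlgebra.ι ℂ w * altWord (FreeAlgebra.ι ℂ) t ∈ content (w :: t) := by
  have h := mul_mem_content (ι_mem_content w) (altWord_mem_content t).1
  exact h

theorem symLie_mem_content (p q : List ι) (w : ι) (t : List ι) :
    symLie p q w t ∈ content (p ++ (q ++ w :: t)) := by
  have h := lie_mem_content (symWord_mem_content q) (letter_mul_altWord_mem_content w t)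
  exact lie_mem_content (symWord_mem_content p) h

theorem symLie_mem_lcs {n : ℕ} (p q : List (Fin n)) (w : Fin n) (t : List (Fin n)) :
    symLie p q w t ∈ lcs n 3 := by
  have h : FreeAlgebra.ι ℂ w * altWord (FreeAlgebra.ι ℂ) t ∈ lcs n 1 := by rw [lcs]; trivial
  have h' := lie_mem_lcs (symWord (FreeAlgebra.ι ℂ) q) h
  exact lie_mem_lcs (symWord (FreeAlgebra.ι ℂ) p) h'

theorem posFun_symLie [LinearOrder ι] {p q t : List ι} {w : ι} (hn : (p ++ (q ++ w :: t)).Nodup)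
    (ht : Even t.length) {S : Finset ι} (hS : Odd S.card) (hSl : ∀ i ∈ S, i ∈ p ++ (q ++ w :: t))
    {j : ι} (hj : j ∈ S) :
    posFun S j (symLie p q w t) =
      if (p.filter (· ∈ S)).length = 1 ∧ (q.filter (· ∈ S)).length = 1 ∧ ∀ k ∈ w :: t, k ∈ S then
        2 * (1 - if j ∈ p then (S.card : ℂ) else 0) *
          wordSign (p.filter (· ∈ S) ++ (q.filter (· ∈ S) ++ w :: t))
      else 0 := by
  have hlen := length_filter_mem hn hSl
  rw [List.filter_append, List.length_append] at hlen
  have hp := symWord_mem_content p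
  have hq := symWord_mem_content q
  have hy := (altWord_mem_content t).1
  have hc := letter_mul_altWord_mem_content w t
  have hqc := lie_mem_content hq hc
  rw [symLie, posFun_lie hn hj (hSl j hj) (hlen ▸ hS) hp hqc, signFun_lie S hq hc]
  have hm := signFun_mul S (ι_mem_content w) hy
  rw [hm, signFun_letter, (signFun_altWord S t).1 ht, signFun_symWord, signFun_symWord]
  by_cases hts : ∀ k ∈ t, k ∈ S
  swap
  · refine Eq.trans ?_ (if_neg fun h' => hts fun k hk => h'.2.2 k (List.mem_cons_of_mem _ hk)).symm
    simp [if_neg hts]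
  have hft : t.filter (· ∈ S) = t := List.filter_eq_self.2 (by simpa using hts)
  rw [if_pos hts]
  by_cases hw : w ∈ S
  swap
  · refine Eq.trans ?_ (if_neg fun h' => hw (h'.2.2 w List.mem_cons_self)).symm
    rw [List.filter_cons_of_neg (by simpa), hft, (ht.mul_left _).neg_one_pow]
    simp
  have hfw : (w :: t).filter (· ∈ S) = w :: t := by simp [hw, hft]
  rw [List.filter_append, hfw, List.length_append] at hlen
  rw [List.filter_append, hfw, List.length_append]
  have hall : ∀ k ∈ w :: t, k ∈ S := by simpa [hw] using hts
  have hodd : Odd (w :: t).length := by simpa using ht.add_one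
  by_cases hq1 : (q.filter (· ∈ S)).length = 1
  swap
  · refine Eq.trans ?_ (if_neg fun h' => hq1 h'.2.1).symm
    rcases Nat.lt_or_gt_of_ne hq1 with h0 | h0
    · rw [Nat.lt_one_iff.1 h0]
      simp
    · rw [if_neg (by omega : ¬ (q.filter (· ∈ S)).length ≤ 1)]
      simp
  by_cases hp1 : (p.filter (· ∈ S)).length = 1
  swap
  · refine Eq.trans ?_ (if_neg fun h' => hp1 h'.1).symm
    have : ¬ (p.filter (· ∈ S)).length ≤ 1 := by
      intro h'
      have h0 : (p.filter (· ∈ S)).length = 0 := by omega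
      rw [← hlen, h0, hq1, Nat.odd_iff] at hS
      rw [Nat.odd_iff] at hodd
      omega
    simp [if_neg this]
  refine Eq.trans ?_ (if_pos ⟨hp1, hq1, hall⟩).symm
  rw [← hlen, if_pos hq1.le, if_pos hp1.le, hp1, hq1, one_mul,
    hodd.neg_one_pow, wordSign_append, wordSign_append, crossSign_append_right]
  obtain ⟨x, hx⟩ := List.length_eq_one_iff.1 hp1
  obtain ⟨y, hy⟩ := List.length_eq_one_iff.1 hq1
  rw [hx, hy, hft, show w :: t = [w] ++ t from rfl, wordSign_append]
  rw [show [w].filter (· ∈ S) = [w] by simp [hw]]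
  have h1 (i : ι) : wordSign [i] = 1 := by simp
  simp only [h1]
  split_ifs <;> push_cast <;> ring

/-- An element of the third step of the lower central series whose position functionals are
supported on the single set `{u, v, w} ∪ t`. -/
noncomputable def dualElt (u v : ι) (L : List ι) (w : ι) (t : List ι) : FreeAlgebra ℂ ι :=
  symLie [u] (v :: L) w t + symLie [v] (u :: L) w t - symLie [u, v] L w t

theorem dualElt_mem_content (u v : ι) (L : List ι) (w : ι) (t : List ι) :
    dualElt u v L w t ∈ content (u :: v :: (L ++ w :: t)) := by
  have h1 := symLie_mem_content [u] (v :: L) w t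
  have h2 := symLie_mem_content [v] (u :: L) w t
  have h3 := symLie_mem_content [u, v] L w t
  replace h2 := content_congr (List.Perm.swap u v (L ++ w :: t)) ▸ h2
  exact sub_mem (add_mem h1 h2) h3

theorem dualElt_mem_lcs {n : ℕ} (u v : Fin n) (L : List (Fin n)) (w : Fin n) (t : List (Fin n)) :
    dualElt u v L w t ∈ lcs n 3 :=
  sub_mem (add_mem (symLie_mem_lcs _ _ _ _) (symLie_mem_lcs _ _ _ _)) (symLie_mem_lcs _ _ _ _)

theorem posFun_dualElt [LinearOrder ι] {u v w : ι} {L t : List ι}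
    (hn : (u :: v :: (L ++ w :: t)).Nodup) (ht : Even t.length) {S : Finset ι} (hS : Odd S.card)
    (hSl : ∀ i ∈ S, i ∈ u :: v :: (L ++ w :: t)) {j : ι} (hj : j ∈ S) :
    posFun S j (dualElt u v L w t) =
      if S = (u :: v :: w :: t).toFinset then
        2 * (S.card : ℂ) * wordSign (u :: v :: w :: t) *
          ((if j = v then 1 else 0) - if j = u then 1 else 0)
      else 0 := by
  have hperm := List.Perm.swap v u (L ++ w :: t)
  have h1 := posFun_symLie (p := [u]) (q := v :: L) hn ht hS hSl hj
  have h2 := posFun_symLie (p := [v]) (q := u :: L) (hperm.nodup_iff.1 hn) ht hS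
    (fun i hi => hperm.mem_iff.1 (hSl i hi)) hj
  have h3 := posFun_symLie (p := [u, v]) (q := L) hn ht hS hSl hj
  rw [dualElt, map_sub, map_add, h1, h2, h3]
  have hne : u ≠ v := fun h => by simp [h] at hn
  have hiff : S = (u :: v :: w :: t).toFinset ↔
      u ∈ S ∧ v ∈ S ∧ (L.filter (· ∈ S)).length = 0 ∧ ∀ k ∈ w :: t, k ∈ S := by
    constructor
    · rintro rfl
      refine ⟨by simp, by simp, ?_, fun k hk => by simpa using Or.inr (Or.inr (List.mem_cons.1 hk))⟩
      rw [List.length_eq_zero_iff, List.filter_eq_nil_iff]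
      simp only [List.nodup_cons, List.mem_cons, List.mem_append, List.nodup_append] at hn
      intro a ha
      have := hn.2.2.2.2 a ha
      simp only [List.mem_toFinset, List.mem_cons, decide_eq_true_eq]
      rintro (rfl | rfl | rfl | h)
      · exact hn.1 (Or.inr (Or.inl ha))
      · exact hn.2.1 (Or.inl ha)
      · exact this a (Or.inl rfl) rfl
      · exact this a (Or.inr h) rfl
    · rintro ⟨hu, hv, hL, hwt⟩
      rw [List.length_eq_zero_iff, List.filter_eq_nil_iff] at hL
      ext i
      rw [List.mem_toFinset]
      refine ⟨fun hi => ?_, fun hi => ?_⟩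
      · have := hSl i hi
        simp only [List.mem_cons, List.mem_append] at this ⊢
        rcases this with h | h | h | h
        · exact Or.inl h
        · exact Or.inr (Or.inl h)
        · exact absurd (by simpa using hi) (hL i h)
        · exact Or.inr (Or.inr h)
      · rcases List.mem_cons.1 hi with rfl | hi
        · exact hu
        rcases List.mem_cons.1 hi with rfl | hi
        · exact hv
        · exact hwt i hi
  rw [if_congr hiff rfl rfl]
  by_cases hC : ∀ k ∈ w :: t, k ∈ S
  swap
  · simp only [iff_false_intro hC, and_false, if_false]
    ring
  simp only [iff_true_intro hC, and_true]
  simp only [List.filter_cons, List.filter_nil, decide_eq_true_eq]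
  have hs : wordSign (v :: u :: w :: t) = -wordSign (u :: v :: w :: t) := by
    simp [pairSign_swap u v]
    ring
  generalize L.filter (· ∈ S) = M
  by_cases hu : u ∈ S <;> by_cases hv : v ∈ S
  · rcases M with _ | ⟨m, M⟩
    · simp [hu, hv, -wordSign_cons, hs]
      split_ifs <;> ring
    · simp [hu, hv]
  · have hjv : j ≠ v := fun h => hv (h ▸ hj)
    simp [hu, hv, hjv]
  · have hju : j ≠ u := fun h => hu (h ▸ hj)
    simp [hu, hv, hju]
  · simp [hu, hv]

end DualElements

section Dimension

variable {n : ℕ}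

theorem exists_mem_lcs_three (S : Finset (Fin n)) (hS : Odd S.card) {u v : Fin n} (hu : u ∈ S)
    (hv : v ∈ S) (huv : u ≠ v) :
    ∃ z ∈ lcs n 3 ⊓ content (List.finRange n), ∃ κ : ℂ, κ ≠ 0 ∧ ∀ S' : Finset (Fin n),
      Odd S'.card → ∀ j ∈ S', posFun S' j z =
        if S' = S then κ * ((if j = v then 1 else 0) - if j = u then 1 else 0) else 0 := by
  have hv' : v ∈ S.erase u := Finset.mem_erase.2 ⟨huv.symm, hv⟩
  have hcard : ((S.erase u).erase v).card = S.card - 2 := by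
    rw [Finset.card_erase_of_mem hv', Finset.card_erase_of_mem hu]
    omega
  have h2 : 2 ≤ S.card := Finset.one_lt_card.2 ⟨u, hu, v, hv, huv⟩
  have hodd : Odd ((S.erase u).erase v).card := by
    rw [hcard]
    exact Nat.Odd.sub_even h2 hS even_two
  obtain ⟨w, hw⟩ := Finset.card_pos.1 hodd.pos
  set T := ((S.erase u).erase v).erase w with hT
  have hTc : Even T.toList.length := by
    rw [Finset.length_toList, hT, Finset.card_erase_of_mem hw]
    exact Nat.Odd.sub_odd hodd odd_one
  have hmem (i : Fin n) : i ∈ u :: v :: w :: T.toList ↔ i ∈ S := by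
    simp only [Finset.mem_erase] at hw
    simp only [List.mem_cons, Finset.mem_toList, hT, Finset.mem_erase]
    grind
  have hnS : (u :: v :: w :: T.toList).Nodup := by
    simp only [Finset.mem_erase] at hw
    simp only [List.nodup_cons, List.mem_cons, Finset.mem_toList, Finset.nodup_toList, hT,
      Finset.mem_erase]
    grind
  have hperm : (u :: v :: (Sᶜ.toList ++ w :: T.toList)).Perm
      (u :: v :: w :: T.toList ++ Sᶜ.toList) :=
    (List.perm_append_comm.cons v).cons u
  have hn : (u :: v :: (Sᶜ.toList ++ w :: T.toList)).Nodup := by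
    rw [hperm.nodup_iff, List.nodup_append]
    refine ⟨hnS, Finset.nodup_toList _, fun a ha b hb hab => ?_⟩
    rw [Finset.mem_toList, Finset.mem_compl, ← hab] at hb
    exact hb ((hmem a).1 ha)
  have hall (i : Fin n) : i ∈ u :: v :: (Sᶜ.toList ++ w :: T.toList) := by
    rw [hperm.mem_iff, List.mem_append, hmem, Finset.mem_toList, Finset.mem_compl]
    exact em _
  have hfin : (u :: v :: (Sᶜ.toList ++ w :: T.toList)).Perm (List.finRange n) :=
    (List.perm_ext_iff_of_nodup hn (List.nodup_finRange n)).2 fun i =>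
      ⟨fun _ => List.mem_finRange i, fun _ => hall i⟩
  have hSe : (u :: v :: w :: T.toList).toFinset = S := by
    ext i
    rw [List.mem_toFinset, hmem]
  refine ⟨dualElt u v Sᶜ.toList w T.toList, ⟨dualElt_mem_lcs _ _ _ _ _, ?_⟩,
    2 * (S.card : ℂ) * wordSign (u :: v :: w :: T.toList), ?_, fun S' hS' j hj => ?_⟩
  · have h := dualElt_mem_content u v Sᶜ.toList w T.toList
    rwa [content_congr hfin] at h
  · have h0 : wordSign (u :: v :: w :: T.toList) ≠ 0 := fun h => by
      simpa [h] using wordSign_mul_self hnS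
    have h1 : (S.card : ℂ) ≠ 0 := by
      norm_cast
      omega
    exact mul_ne_zero (mul_ne_zero two_ne_zero h1) h0
  · have h := posFun_dualElt hn hTc hS' (fun i _ => hall i) hj
    rw [h]
    by_cases hSS : S' = S
    · rw [if_pos hSS, if_pos (hSS.trans hSe.symm), hSS]
    · rw [if_neg hSS, if_neg fun h => hSS (h.trans hSe)]

theorem sum_powerset_odd_even {α : Type*} [DecidableEq α] {m : ℕ} (hm : 2 ≤ m) :
    ∀ (s : Finset α) (c : ℤ), s.card = m →
      4 * ∑ S ∈ s.powerset, (if Odd S.card then (S.card : ℤ) + c else 0) = (m + 2 * c) * 2 ^ m ∧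
      4 * ∑ S ∈ s.powerset, (if Even S.card then (S.card : ℤ) + c else 0) = (m + 2 * c) * 2 ^ m := by
  have step (a : α) (s : Finset α) (ha : a ∉ s) (c : ℤ) :
      ∑ S ∈ (insert a s).powerset, (if Odd S.card then (S.card : ℤ) + c else 0) =
        ∑ S ∈ s.powerset, (if Odd S.card then (S.card : ℤ) + c else 0) +
        ∑ S ∈ s.powerset, (if Even S.card then (S.card : ℤ) + (c + 1) else 0) ∧
      ∑ S ∈ (insert a s).powerset, (if Even S.card then (S.card : ℤ) + c else 0) =
        ∑ S ∈ s.powerset, (if Even S.card then (S.card : ℤ) + c else 0) +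
        ∑ S ∈ s.powerset, (if Odd S.card then (S.card : ℤ) + (c + 1) else 0) := by
    rw [Finset.sum_powerset_insert ha, Finset.sum_powerset_insert ha]
    constructor <;> refine congrArg _ (Finset.sum_congr rfl fun S hS => ?_) <;>
      rw [Finset.card_insert_of_notMem fun h => ha (Finset.mem_powerset.1 hS h)]
    · simp only [Nat.odd_add_one, Nat.not_odd_iff_even, Nat.cast_add, Nat.cast_one]
      split_ifs <;> ring
    · simp only [Nat.even_add_one, Nat.not_even_iff_odd, Nat.cast_add, Nat.cast_one]
      split_ifs <;> ring
  induction m, hm using Nat.le_induction with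
  | base =>
    intro s c hs
    obtain ⟨x, y, hxy, rfl⟩ := Finset.card_eq_two.1 hs
    have h1 := step x {y} (by simpa using hxy) c
    have h2 := step y ∅ (by simp) c
    have h3 := step y ∅ (by simp) (c + 1)
    simp only [insert_empty_eq, Finset.powerset_empty, Finset.sum_singleton, Finset.card_empty]
      at h2 h3
    rw [h1.1, h1.2, h2.1, h2.2, h3.1, h3.2]
    norm_num
    constructor <;> ring
  | succ m hm ih =>
    intro s c hs
    obtain ⟨a, s, ha, rfl, h_card⟩ := Finset.card_eq_succ.1 hs
    obtain ⟨h1, h2⟩ := ih s c h_card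
    obtain ⟨h3, h4⟩ := ih s (c + 1) h_card
    rw [(step a s ha c).1, (step a s ha c).2, mul_add, mul_add, h1, h2, h3, h4]
    push_cast
    constructor <;> ring

theorem sum_odd_card_sub_one (hn : 2 ≤ n) :
    ∑ S : Finset (Fin n) with Odd S.card, (S.card - 1) = (n - 2) * 2 ^ (n - 2) := by
  have h := (sum_powerset_odd_even hn (Finset.univ : Finset (Fin n)) (-1) (by simp)).1
  rw [Finset.powerset_univ, ← Finset.sum_filter] at h
  zify [hn]
  rw [Finset.sum_congr rfl fun S hS => Nat.cast_pred (Finset.mem_filter.1 hS).2.pos]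
  obtain ⟨m, rfl⟩ := Nat.exists_eq_add_of_le hn
  rw [show 2 + m - 2 = m by omega]
  rw [pow_add] at h
  push_cast at h ⊢
  simp only [sub_eq_add_neg]
  linarith

theorem multilinearPart_eq_content : multilinearPart n = content (List.finRange n) := by
  rw [multilinearPart, content]
  congr 1
  ext y
  constructor
  · rintro ⟨σ, rfl⟩
    refine ⟨List.ofFn σ, ?_, ?_⟩
    · rw [Set.mem_ofPred_eq, List.perm_ext_iff_of_nodup (List.nodup_ofFn.2 σ.injective)
        (List.nodup_finRange n)]
      exact fun i => ⟨fun _ => List.mem_finRange i,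
        fun _ => (List.mem_ofFn' _ _).2 (σ.surjective i)⟩
    · rw [word, List.map_ofFn]
      rfl
  · rintro ⟨l, hl, rfl⟩
    have hlen : l.length = n := by rw [hl.length_eq, List.length_finRange]
    obtain ⟨f, rfl⟩ : ∃ f : Fin n → Fin n, l = List.ofFn f :=
      ⟨fun i => l.get (i.cast hlen.symm), List.ext_getElem (by simpa using hlen) (by simp)⟩
    have hinj := List.nodup_ofFn.1 (hl.nodup_iff.2 (List.nodup_finRange n))
    refine ⟨Equiv.ofBijective f (Finite.injective_iff_bijective.1 hinj), ?_⟩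
    rw [word, List.map_ofFn]
    rfl

/-- An element of `S`, equal to `o` whenever `o` lies in `S`. -/
noncomputable def basePoint (o : Fin n) (S : Finset (Fin n)) : Fin n :=
  if o ∈ S then o else if h : S.Nonempty then h.choose else o

theorem basePoint_of_mem {o : Fin n} {S : Finset (Fin n)} (h : o ∈ S) : basePoint o S = o :=
  if_pos h

theorem basePoint_mem (o : Fin n) {S : Finset (Fin n)} (h : S.Nonempty) : basePoint o S ∈ S := by
  unfold basePoint
  split_ifs with ho
  · exact ho
  · exact h.choose_spec

/-- The pairs `(S, j)` of a set `S` of odd size and an element `j` of `S` other than the base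
point. -/
noncomputable def oddPointed (o : Fin n) : Finset (Σ _ : Finset (Fin n), Fin n) :=
  (Finset.univ.filter fun S : Finset (Fin n) => Odd S.card).sigma fun S => S.erase (basePoint o S)

theorem mem_oddPointed {o : Fin n} {x : Σ _ : Finset (Fin n), Fin n} :
    x ∈ oddPointed o ↔ Odd x.1.card ∧ x.2 ≠ basePoint o x.1 ∧ x.2 ∈ x.1 := by
  simp [oddPointed]

theorem card_oddPointed (hn : 2 ≤ n) (o : Fin n) :
    (oddPointed o).card = (n - 2) * 2 ^ (n - 2) := by
  rw [oddPointed, Finset.card_sigma, ← sum_odd_card_sub_one hn]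
  exact Finset.sum_congr rfl fun S hS => Finset.card_erase_of_mem
    (basePoint_mem o (Finset.card_pos.1 (Finset.mem_filter.1 hS).2.pos))

/-- The position functionals indexed by `oddPointed`, on the multilinear part of the third step
of the lower central series. -/
noncomputable def posMap (o : Fin n) :
    ↥(lcs n 3 ⊓ content (List.finRange n)) →ₗ[ℂ] (oddPointed o → ℂ) :=
  (LinearMap.pi fun i : oddPointed o => posFun i.1.1 i.1.2) ∘ₗ Submodule.subtype _

theorem posMap_apply (o : Fin n) (x : ↥(lcs n 3 ⊓ content (List.finRange n)))
    (i : oddPointed o) : posMap o x i = posFun i.1.1 i.1.2 x.1 := rfl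

theorem range_posMap (o : Fin n) : LinearMap.range (posMap o) = ⊤ := by
  rw [eq_top_iff, ← (Pi.basisFun ℂ (oddPointed o)).span_eq, Submodule.span_le]
  rintro _ ⟨⟨⟨S, u⟩, hi⟩, rfl⟩
  obtain ⟨hS, hne, hu⟩ := mem_oddPointed.1 hi
  obtain ⟨z, hz, κ, hκ, h⟩ :=
    exists_mem_lcs_three S hS hu (basePoint_mem o (Finset.card_pos.1 hS.pos)) hne
  refine ⟨(-κ⁻¹) • ⟨z, hz⟩, ?_⟩
  ext ⟨⟨S', j⟩, hj⟩
  obtain ⟨hS', hjne, hjS⟩ := mem_oddPointed.1 hj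
  rw [map_smul, Pi.smul_apply, posMap_apply, h S' hS' j hjS, Pi.basisFun_apply, Pi.single_apply]
  by_cases hSS : S' = S
  · subst hSS
    by_cases hju : j = u
    · subst hju
      simp [hjne, hκ]
    · simp [hjne, hju]
  · simp [hSS]

theorem ker_posMap (o : Fin n) :
    LinearMap.ker (posMap o) = Submodule.comap (lcs n 3 ⊓ content (List.finRange n)).subtype
      (lcs n 4 ⊓ content (List.finRange n)) := by
  ext ⟨x, hx⟩
  have hl := List.nodup_finRange n
  have hm := List.mem_finRange (n := n)
  rw [LinearMap.mem_ker, Submodule.mem_comap]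
  refine ⟨fun h => ⟨?_, hx.2⟩, fun h => ?_⟩
  · refine mem_lcs_four hl hm o (basePoint o) (fun S => basePoint_of_mem) hx.1 hx.2
      fun S hS j hj hjb => ?_
    exact congrFun h ⟨⟨S, j⟩, mem_oddPointed.2 ⟨hS, hjb, hj⟩⟩
  · ext ⟨⟨S, j⟩, hi⟩
    obtain ⟨hS, -, hj⟩ := mem_oddPointed.1 hi
    exact posFun_eq_zero_of_mem_lcs hl hm hS hj h.1 hx.2

end Dimension

/-- `dim_ℂ ((L_3 ∩ P)/(L_4 ∩ P)) = (n−2)·2^{n−2}`, where `P` is the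
multilinear component of `A_n`. -/
theorem stmt_13 (n : ℕ) (hn : 2 ≤ n) :
    Module.finrank ℂ
      (↥(lcs n 3 ⊓ multilinearPart n) ⧸
        Submodule.comap (lcs n 3 ⊓ multilinearPart n).subtype (lcs n 4 ⊓ multilinearPart n))
      = (n - 2) * 2 ^ (n - 2) := by
  have o : Fin n := ⟨0, by omega⟩
  rw [multilinearPart_eq_content, ← ker_posMap o,
    (LinearMap.quotKerEquivOfSurjective _ (LinearMap.range_eq_top.1 (range_posMap o))).finrank_eq,
    Module.finrank_fintype_fun_eq_card, Fintype.card_coe, card_oddPointed hn]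
end

section
/- Let m ≥ 2 and suppose p and q are real polynomials of degree 1 such that, for all sufficiently large d, dim_ℂ B_m(A_2)[d] = p(d) and dim_ℂ B_{m+1}(A_2)[d] = q(d). Then the leading coefficient of q is at most 3 times the leading coefficient of p; i.e. the density satisfies a_{m+1,2} ≤ 3·a_{m,2}. -/
/-- The degree-`d` component `A[d]` of the free algebra: the ℂ-span of the monomials
of total degree `d` in the generators. -/
def gradeComp (n d : ℕ) : Submodule ℂ (FreeAlgebra ℂ (Fin n)) :=
  Submodule.span ℂ
    {y | ∃ w : Fin d → Fin n, y = (List.ofFn fun i : Fin d => FreeAlgebra.ι ℂ (w i)).prod}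

/-- `dim_ℂ B_m(A_n)[d] = dim_ℂ ((L_m ∩ A[d])/(L_{m+1} ∩ A[d]))`. -/
noncomputable def dimB (n m d : ℕ) : ℕ :=
  Module.finrank ℂ
    (↥(lcs n m ⊓ gradeComp n d) ⧸
      Submodule.comap (lcs n m ⊓ gradeComp n d).subtype (lcs n (m + 1) ⊓ gradeComp n d))

section LowerCentral

variable {A : Type*} [Ring A] [Algebra ℂ A]

variable (A) in
/-- The lower central series of an associative algebra, indexed from `0`. -/
def lowerC : ℕ → Submodule ℂ A
  | 0 => ⊤
  | k + 1 => Submodule.span ℂ {y | ∃ a w, w ∈ lowerC k ∧ y = a * w - w * a}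

variable (A) in
/-- The ideal generated by the `k`-th term of the lower central series. -/
def lowerI (k : ℕ) : Submodule ℂ A := ⊤ * lowerC A k

theorem comm_mem_lowerC {k : ℕ} (a : A) {w : A} (hw : w ∈ lowerC A k) :
    a * w - w * a ∈ lowerC A (k + 1) :=
  Submodule.subset_span ⟨a, w, hw, rfl⟩

/-- To check that `lowerC A (k + 1)` lies in a submodule, check it on commutators. -/
theorem lowerC_succ_le {k : ℕ} {Z : Submodule ℂ A}
    (h : ∀ a w, w ∈ lowerC A k → a * w - w * a ∈ Z) : lowerC A (k + 1) ≤ Z := by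
  refine Submodule.span_le.2 ?_
  rintro _ ⟨a, w, hw, rfl⟩
  exact h a w hw

theorem lowerC_succ_le_self (k : ℕ) : lowerC A (k + 1) ≤ lowerC A k := by
  induction k with
  | zero => exact le_top
  | succ k ih => exact lowerC_succ_le fun a w hw => comm_mem_lowerC a (ih hw)

theorem lowerC_antitone : Antitone (lowerC A) := antitone_nat_of_succ_le lowerC_succ_le_self

theorem comm_lowerC_lowerC (i j : ℕ) {u w : A} (hu : u ∈ lowerC A i) (hw : w ∈ lowerC A j) :
    u * w - w * u ∈ lowerC A (i + j + 1) := by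
  induction i generalizing j u w with
  | zero => simpa using comm_mem_lowerC u hw
  | succ i ih =>
    let Z : Submodule ℂ A := (lowerC A (i + 1 + j + 1)).comap
      (LinearMap.mulRight ℂ w - LinearMap.mulLeft ℂ w)
    have hZ : ∀ v, v ∈ Z ↔ v * w - w * v ∈ lowerC A (i + 1 + j + 1) := fun v => by simp [Z]
    rw [← hZ]
    refine lowerC_succ_le (fun a v hv => ?_) hu
    rw [hZ]
    have h1 := comm_mem_lowerC a (ih j hv hw)
    have h2 := ih (j + 1) hv (comm_mem_lowerC a hw)
    rw [show i + j + 1 + 1 = i + 1 + j + 1 by ring] at h1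
    rw [show i + (j + 1) + 1 = i + 1 + j + 1 by ring] at h2
    convert Submodule.sub_mem _ h1 h2 using 1
    noncomm_ring

theorem lowerC_le_lowerI (k : ℕ) : lowerC A k ≤ lowerI A k := fun w hw => by
  rw [← one_mul w]
  exact Submodule.mul_mem_mul Submodule.mem_top hw

theorem mul_mem_lowerI_of_mem_lowerC {k : ℕ} (a : A) {w : A} (hw : w ∈ lowerC A k) :
    a * w ∈ lowerI A k := Submodule.mul_mem_mul Submodule.mem_top hw

theorem lowerI_le {k : ℕ} {Z : Submodule ℂ A}
    (h : ∀ a w, w ∈ lowerC A k → a * w ∈ Z) : lowerI A k ≤ Z :=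
  Submodule.mul_le.2 fun a _ w hw => h a w hw

theorem mul_left_mem_lowerI {k : ℕ} (a : A) {w : A} (hw : w ∈ lowerI A k) :
    a * w ∈ lowerI A k := by
  have : lowerI A k ≤ (lowerI A k).comap (LinearMap.mulLeft ℂ a) :=
    lowerI_le fun b v hv => by
      simpa [mul_assoc] using mul_mem_lowerI_of_mem_lowerC (a * b) hv
  simpa using this hw

theorem mul_right_mem_lowerI {k : ℕ} (a : A) {w : A} (hw : w ∈ lowerI A k) :
    w * a ∈ lowerI A k := by
  have : lowerI A k ≤ (lowerI A k).comap (LinearMap.mulRight ℂ a) :=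
    lowerI_le fun b v hv => by
      have h1 := mul_mem_lowerI_of_mem_lowerC (b * a) hv
      have h2 := mul_mem_lowerI_of_mem_lowerC b (lowerC_succ_le_self k (comm_mem_lowerC a hv))
      have h3 := Submodule.sub_mem _ h1 h2
      simp only [Submodule.mem_comap, LinearMap.mulRight_apply]
      convert h3 using 1
      noncomm_ring
  simpa using this hw

theorem lowerI_antitone : Antitone (lowerI A) := fun _ _ h =>
  lowerI_le fun a _ hw => mul_mem_lowerI_of_mem_lowerC a (lowerC_antitone h hw)

/-- Commutators with a submodule stable under multiplication are controlled by
commutators with generators. -/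
theorem comm_mem_of_adjoin {x y : A} (hgen : Algebra.adjoin ℂ {x, y} = ⊤) {I Z : Submodule ℂ A}
    (hl : ∀ a w, w ∈ I → a * w ∈ I) (hr : ∀ a w, w ∈ I → w * a ∈ I)
    (hx : ∀ w ∈ I, x * w - w * x ∈ Z) (hy : ∀ w ∈ I, y * w - w * y ∈ Z)
    (a : A) {w : A} (hw : w ∈ I) : a * w - w * a ∈ Z := by
  have ha : a ∈ Algebra.adjoin ℂ {x, y} := hgen ▸ Algebra.mem_top
  induction ha using Algebra.adjoin_induction generalizing w with
  | mem z hz =>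
    rcases hz with rfl | rfl
    · exact hx w hw
    · exact hy w hw
  | algebraMap r => simp [Algebra.commutes r w]
  | add a b _ _ iha ihb =>
    convert Submodule.add_mem _ (iha hw) (ihb hw) using 1
    noncomm_ring
  | mul a b _ _ iha ihb =>
    convert Submodule.add_mem _ (iha (hl b w hw)) (ihb (hr a w hw)) using 1
    noncomm_ring

/-- In a two-generated algebra every commutator lies in the ideal of `[x, y]`. -/
theorem comm_mem_ideal {x y : A} (hgen : Algebra.adjoin ℂ {x, y} = ⊤) {J : Submodule ℂ A}
    (hl : ∀ a w, w ∈ J → a * w ∈ J) (hr : ∀ a w, w ∈ J → w * a ∈ J)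
    (hJ : x * y - y * x ∈ J) (a b : A) : a * b - b * a ∈ J := by
  have key : ∀ z : A, x * z - z * x ∈ J → y * z - z * y ∈ J → ∀ a, a * z - z * a ∈ J := by
    intro z hx hy a
    have ha : a ∈ Algebra.adjoin ℂ {x, y} := hgen ▸ Algebra.mem_top
    induction ha using Algebra.adjoin_induction with
    | mem t ht => rcases ht with rfl | rfl <;> assumption
    | algebraMap r => simp [Algebra.commutes r z]
    | add a b _ _ iha ihb => convert Submodule.add_mem _ iha ihb using 1; noncomm_ring
    | mul a b _ _ iha ihb =>
      convert Submodule.add_mem _ (hr b _ iha) (hl a _ ihb) using 1; noncomm_ring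
  have hJ' : y * x - x * y ∈ J := by simpa using Submodule.neg_mem _ hJ
  refine key b ?_ ?_ a
  · simpa using Submodule.neg_mem _ (key x (by simp) hJ' b)
  · simpa using Submodule.neg_mem _ (key y hJ (by simp) b)

theorem lowerI_one_le {x y : A} (hgen : Algebra.adjoin ℂ {x, y} = ⊤) {Z : Submodule ℂ A}
    (h : ∀ a b, a * (x * y - y * x) * b ∈ Z) : lowerI A 1 ≤ Z := by
  let J : Submodule ℂ A := ⊤ * Submodule.span ℂ {x * y - y * x} * ⊤
  have hJ : ∀ a b, a * (x * y - y * x) * b ∈ J := fun a b =>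
    Submodule.mul_mem_mul (Submodule.mul_mem_mul Submodule.mem_top
      (Submodule.mem_span_singleton_self _)) Submodule.mem_top
  have hJle : ∀ Y : Submodule ℂ A, (∀ a b, a * (x * y - y * x) * b ∈ Y) → J ≤ Y := by
    intro Y hY
    refine Submodule.mul_le.2 fun m hm b _ => ?_
    have : ⊤ * Submodule.span ℂ {x * y - y * x} ≤ Y.comap (LinearMap.mulRight ℂ b) := by
      refine Submodule.mul_le.2 fun a _ n hn => ?_
      obtain ⟨r, rfl⟩ := Submodule.mem_span_singleton.1 hn
      simpa using Submodule.smul_mem _ r (hY a b)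
    simpa using this hm
  have hl : ∀ a w, w ∈ J → a * w ∈ J := fun a w hw => by
    have := hJle (J.comap (LinearMap.mulLeft ℂ a)) fun b c => by
      simpa [mul_assoc] using hJ (a * b) c
    simpa using this hw
  have hr : ∀ a w, w ∈ J → w * a ∈ J := fun a w hw => by
    have := hJle (J.comap (LinearMap.mulRight ℂ a)) fun b c => by
      simpa [mul_assoc] using hJ b (c * a)
    simpa using this hw
  refine le_trans (lowerI_le fun a w hw => hl a w ?_) (hJle Z h)
  refine lowerC_succ_le (fun b c _ => ?_) hw
  exact comm_mem_ideal hgen hl hr (by simpa using hJ 1 1) b c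

theorem comm_left_mem_of_base {x y : A} {R : Submodule ℂ A}
    (hx : ∀ w ∈ lowerC A 1, x * w - w * x ∈ R) (hy : ∀ w ∈ lowerC A 1, y * w - w * y ∈ R)
    (hxy : ∀ w ∈ lowerC A 1, x * y * w - w * (x * y) ∈ R) (a b : A) :
    x * (a * (x * y - y * x) * b) - a * (x * y - y * x) * b * x ∈ R := by
  have hC : ∀ a b : A, a * b - b * a ∈ lowerC A 1 := fun a b =>
    comm_mem_lowerC a Submodule.mem_top
  have h1 := hx _ (hC a ((x * y - y * x) * b))
  have h2 := hx _ (hC x (y * (b * a)))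
  have h3 := hxy _ (hC x (b * a))
  have h4 := hy _ (hC x (b * a * x))
  convert R.sub_mem (R.add_mem h1 h2) (R.sub_mem h3 h4) using 1
  noncomm_ring

theorem comm_lowerI_one_mem {x y : A} (hgen : Algebra.adjoin ℂ {x, y} = ⊤) {R : Submodule ℂ A}
    (hR : lowerC A 3 ≤ R)
    (hx : ∀ w ∈ lowerC A 1, x * w - w * x ∈ R) (hy : ∀ w ∈ lowerC A 1, y * w - w * y ∈ R)
    (hxy : ∀ w ∈ lowerC A 1, x * y * w - w * (x * y) ∈ R) (c : A) {w : A}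
    (hw : w ∈ lowerI A 1) : c * w - w * c ∈ R := by
  refine comm_mem_of_adjoin hgen (fun a w => mul_left_mem_lowerI a)
    (fun a w => mul_right_mem_lowerI a) (fun w hw => ?_) (fun w hw => ?_) c hw
  · have : lowerI A 1 ≤ R.comap (LinearMap.mulLeft ℂ x - LinearMap.mulRight ℂ x) :=
      lowerI_one_le hgen fun a b => by simpa using comm_left_mem_of_base hx hy hxy a b
    simpa using this hw
  · have hyx : ∀ w ∈ lowerC A 1, y * x * w - w * (y * x) ∈ R := fun w hw => by
      have h1 := hR (comm_lowerC_lowerC 1 1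
        (comm_mem_lowerC x (Submodule.mem_top : y ∈ lowerC A 0)) hw)
      convert R.sub_mem (hxy w hw) h1 using 1
      noncomm_ring
    have : lowerI A 1 ≤ R.comap (LinearMap.mulLeft ℂ y - LinearMap.mulRight ℂ y) :=
      lowerI_one_le hgen fun a b => by
        simp only [Submodule.mem_comap, LinearMap.sub_apply, LinearMap.mulLeft_apply,
          LinearMap.mulRight_apply]
        convert R.neg_mem (comm_left_mem_of_base hy hx hyx a b) using 1
        noncomm_ring
    simpa using this hw

theorem comm_lowerC_lowerI_one {x y : A} (hgen : Algebra.adjoin ℂ {x, y} = ⊤) (k : ℕ) {u w : A}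
    (hu : u ∈ lowerC A k) (hw : w ∈ lowerI A 1) : u * w - w * u ∈ lowerC A (k + 2) := by
  have base : ∀ (c : A) {w : A}, w ∈ lowerI A 1 → c * w - w * c ∈ lowerC A 2 := fun c w hw =>
    comm_lowerI_one_mem hgen (lowerC_succ_le_self 2) (fun w hw => comm_mem_lowerC x hw)
      (fun w hw => comm_mem_lowerC y hw) (fun w hw => comm_mem_lowerC (x * y) hw) c hw
  induction k generalizing u w with
  | zero => exact base u hw
  | succ k ih =>
    have : lowerC A (k + 1) ≤ (lowerC A (k + 1 + 2)).comap
        (LinearMap.mulRight ℂ w - LinearMap.mulLeft ℂ w) := by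
      refine lowerC_succ_le fun a v hv => ?_
      have h1 := comm_mem_lowerC a (ih hv hw)
      have h2 := comm_lowerC_lowerC k 2 hv (base a hw)
      simp only [Submodule.mem_comap, LinearMap.sub_apply, LinearMap.mulLeft_apply,
        LinearMap.mulRight_apply]
      convert Submodule.sub_mem _ h1 h2 using 1
      noncomm_ring
    simpa using this hu

/-- The inclusion `[A, M_k] ⊆ L_{k+1}` (in the indexing from `1`). -/
theorem comm_lowerI {x y : A} (hgen : Algebra.adjoin ℂ {x, y} = ⊤) {k : ℕ} (hk : 1 ≤ k) (c : A)
    {w : A} (hw : w ∈ lowerI A k) : c * w - w * c ∈ lowerC A (k + 1) := by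
  induction k, hk using Nat.le_induction generalizing c w with
  | base => exact comm_lowerC_lowerI_one hgen 0 Submodule.mem_top hw
  | succ k _ ih =>
    have : lowerI A (k + 1) ≤ (lowerC A (k + 1 + 1)).comap
        (LinearMap.mulLeft ℂ c - LinearMap.mulRight ℂ c) := by
      refine lowerI_le fun a w hw => ?_
      have : lowerC A (k + 1) ≤ ((lowerC A (k + 1 + 1)).comap
        (LinearMap.mulLeft ℂ c - LinearMap.mulRight ℂ c)).comap (LinearMap.mulLeft ℂ a) := by
        refine lowerC_succ_le fun b l hl => ?_
        have h1 := comm_mem_lowerC c (ih b (mul_mem_lowerI_of_mem_lowerC a hl))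
        have hω : b * a - a * b ∈ lowerC A 1 := comm_mem_lowerC b Submodule.mem_top
        have h2 := comm_lowerC_lowerI_one hgen k hl (mul_mem_lowerI_of_mem_lowerC c hω)
        have hW := mul_right_mem_lowerI c (lowerC_le_lowerI k hl)
        have h3 := comm_mem_lowerC b (ih a hW)
        have h4 := comm_mem_lowerC a (ih b hW)
        simp only [Submodule.mem_comap, LinearMap.sub_apply, LinearMap.mulLeft_apply,
          LinearMap.mulRight_apply]
        convert Submodule.add_mem _ (Submodule.add_mem _ h1 h2) (Submodule.sub_mem _ h3 h4) using 1
        noncomm_ring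
      simpa using this hw
    simpa using this hw

theorem mul_mem_lowerI_of_lowerC {x y : A} (hgen : Algebra.adjoin ℂ {x, y} = ⊤) (i : ℕ) {j : ℕ}
    (hj : 1 ≤ j) {u w : A} (hu : u ∈ lowerC A i) (hw : w ∈ lowerC A j) :
    u * w ∈ lowerI A (i + j) := by
  induction i generalizing j u w with
  | zero => simpa using mul_mem_lowerI_of_mem_lowerC u hw
  | succ i ih =>
    have : lowerC A (i + 1) ≤ (lowerI A (i + 1 + j)).comap (LinearMap.mulRight ℂ w) := by
      refine lowerC_succ_le fun a p hp => ?_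
      have h1 := lowerC_le_lowerI _ (comm_lowerI hgen (by omega) a (ih hj hp hw))
      have h2 := ih (by omega) hp (comm_mem_lowerC a hw)
      rw [show i + j + 1 = i + 1 + j by ring] at h1
      rw [show i + (j + 1) = i + 1 + j by ring] at h2
      simp only [Submodule.mem_comap, LinearMap.mulRight_apply]
      convert Submodule.sub_mem _ h1 h2 using 1
      noncomm_ring
    simpa using this hu

/-- The inclusion `M_{i+1} M_{j+1} ⊆ M_{i+j+1}` (in the indexing from `1`). -/
theorem mul_mem_lowerI {x y : A} (hgen : Algebra.adjoin ℂ {x, y} = ⊤) (i : ℕ) {j : ℕ}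
    (hj : 1 ≤ j) {u w : A} (hu : u ∈ lowerI A i) (hw : w ∈ lowerI A j) :
    u * w ∈ lowerI A (i + j) := by
  have : lowerI A i ≤ (lowerI A (i + j)).comap (LinearMap.mulRight ℂ w) := by
    refine lowerI_le fun a p hp => ?_
    have : lowerI A j ≤ (lowerI A (i + j)).comap (LinearMap.mulLeft ℂ p) := by
      refine lowerI_le fun b l hl => ?_
      have h1 := mul_left_mem_lowerI b (mul_mem_lowerI_of_lowerC hgen i hj hp hl)
      have h2 := mul_mem_lowerI_of_lowerC hgen i hj
        (lowerC_succ_le_self i (comm_mem_lowerC b hp)) hl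
      simp only [Submodule.mem_comap, LinearMap.mulLeft_apply]
      convert Submodule.sub_mem _ h1 h2 using 1
      noncomm_ring
    have h := mul_left_mem_lowerI a (this hw)
    simpa [mul_assoc] using h
  simpa using this hu

theorem comm_pow_sub_mem_lowerI (x : A) (n : ℕ) {i : ℕ} {w : A} (hw : w ∈ lowerC A i) :
    x ^ (n + 1) * w - w * x ^ (n + 1) - ((n : ℂ) + 1) • (x ^ n * (x * w - w * x)) ∈
      lowerI A (i + 2) := by
  induction n with
  | zero => simp
  | succ n ih =>
    have h1 := mul_left_mem_lowerI x ih
    have h2 := lowerC_le_lowerI _ (comm_mem_lowerC (x ^ (n + 1)) (comm_mem_lowerC x hw))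
    convert Submodule.sub_mem _ h1 h2 using 1
    rw [mul_sub x, mul_smul_comm, ← mul_assoc x (x ^ n), ← pow_succ' x n]
    push_cast
    rw [add_smul ((n : ℂ) + 1) 1, one_smul]
    have e : x ^ (n + 1 + 1) = x * x ^ (n + 1) := pow_succ' x (n + 1)
    have e' : x ^ (n + 1 + 1) = x ^ (n + 1) * x := pow_succ x (n + 1)
    generalize ((n : ℂ) + 1) • (x ^ (n + 1) * (x * w - w * x)) = t
    have c : x * x ^ (n + 1) = x ^ (n + 1) * x := e ▸ e'
    rw [e]
    generalize x ^ (n + 1) = z at *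
    have c2 : w * x * z = w * z * x := by rw [mul_assoc, c, mul_assoc]
    have : x * z * w - w * (x * z) - (t + z * (x * w - w * x)) =
      x * (z * w - w * z) - t - (z * (x * w - w * x) - (x * w - w * x) * z) := by
      noncomm_ring
    exact this

/-- The linear map `w ↦ [z, w]`. -/
noncomputable def bracketLeft (z : A) : A →ₗ[ℂ] A := LinearMap.mulLeft ℂ z - LinearMap.mulRight ℂ z

@[simp]
theorem bracketLeft_apply (z w : A) : bracketLeft z w = z * w - w * z := rfl

theorem span_monomials_sup_lowerI_one {x y : A} (hgen : Algebra.adjoin ℂ {x, y} = ⊤) :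
    Submodule.span ℂ {m | ∃ q p : ℕ, m = y ^ q * x ^ p} ⊔ lowerI A 1 = ⊤ := by
  set T := Submodule.span ℂ {m | ∃ q p : ℕ, m = y ^ q * x ^ p} ⊔ lowerI A 1
  have hI : lowerI A 1 ≤ T := le_sup_right
  have hm : ∀ q p : ℕ, y ^ q * x ^ p ∈ T := fun q p =>
    Submodule.mem_sup_left (Submodule.subset_span ⟨q, p, rfl⟩)
  have hle : ∀ z : A, (∀ q p : ℕ, z * (y ^ q * x ^ p) ∈ T) → ∀ t ∈ T, z * t ∈ T := by
    intro z hz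
    have : T ≤ T.comap (LinearMap.mulLeft ℂ z) := by
      refine sup_le (Submodule.span_le.2 ?_) fun t ht => hI (mul_left_mem_lowerI z ht)
      rintro _ ⟨q, p, rfl⟩
      exact hz q p
    exact this
  have hy : ∀ t ∈ T, y * t ∈ T := hle y fun q p => by
    simpa [pow_succ', mul_assoc] using hm (q + 1) p
  have hx : ∀ t ∈ T, x * t ∈ T := hle x fun q p => by
    have h1 := hm q (p + 1)
    have h2 := hI (mul_right_mem_lowerI (x ^ p) (lowerC_le_lowerI 1
      (comm_mem_lowerC x (Submodule.mem_top : y ^ q ∈ lowerC A 0))))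
    convert T.add_mem h1 h2 using 1
    rw [pow_succ']
    noncomm_ring
  refine eq_top_iff.2 fun a _ => ?_
  have ha : a ∈ Algebra.adjoin ℂ {x, y} := hgen ▸ Algebra.mem_top
  have hmul : ∀ t ∈ T, a * t ∈ T := by
    induction ha using Algebra.adjoin_induction with
    | mem z hz => rcases hz with rfl | rfl <;> assumption
    | algebraMap r =>
        intro t ht
        rw [← Algebra.smul_def]
        exact T.smul_mem r ht
    | add a b _ _ iha ihb =>
        intro t ht
        rw [add_mul]
        exact T.add_mem (iha Submodule.mem_top t ht) (ihb Submodule.mem_top t ht)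
    | mul a b _ _ iha ihb =>
        intro t ht
        rw [mul_assoc]
        exact iha Submodule.mem_top _ (ihb Submodule.mem_top t ht)
  simpa using hmul 1 (by simpa using hm 0 0)

theorem le_of_monomials_of_lowerI_one {x y : A} (hgen : Algebra.adjoin ℂ {x, y} = ⊤)
    {Z : Submodule ℂ A} (hm : ∀ q p : ℕ, y ^ q * x ^ p ∈ Z) (hI : lowerI A 1 ≤ Z) (a : A) :
    a ∈ Z := by
  have h : (⊤ : Submodule ℂ A) ≤ Z := by
    rw [← span_monomials_sup_lowerI_one hgen]
    refine sup_le (Submodule.span_le.2 ?_) hI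
    rintro _ ⟨q, p, rfl⟩
    exact hm q p
  exact h Submodule.mem_top

theorem exists_sub_mul_mem_lowerI_two {x y : A} (hgen : Algebra.adjoin ℂ {x, y} = ⊤) {c : A}
    (hc : c ∈ lowerI A 1) : ∃ a, c - a * (x * y - y * x) ∈ lowerI A 2 := by
  have : lowerI A 1 ≤ LinearMap.range (LinearMap.mulRight ℂ (x * y - y * x)) ⊔ lowerI A 2 := by
    refine lowerI_one_le hgen fun a b => ?_
    have h2 : a * (b * (x * y - y * x) - (x * y - y * x) * b) ∈ lowerI A 2 :=
      mul_mem_lowerI_of_mem_lowerC a (comm_mem_lowerC b (comm_mem_lowerC x Submodule.mem_top))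
    rw [show a * (x * y - y * x) * b = a * b * (x * y - y * x) +
      -(a * (b * (x * y - y * x) - (x * y - y * x) * b)) by noncomm_ring]
    exact Submodule.add_mem_sup ⟨a * b, rfl⟩ (Submodule.neg_mem _ h2)
  obtain ⟨_, ⟨a, rfl⟩, n, hn, rfl⟩ := Submodule.mem_sup.1 (this hc)
  exact ⟨a, by simpa using hn⟩

theorem mul_comm_mem_of_left {x y : A} (hgen : Algebra.adjoin ℂ {x, y} = ⊤) {j : ℕ}
    {K : Submodule ℂ A} (hK : lowerI A (j + 3) ≤ K)
    (hx : ∀ a, ∀ l ∈ lowerC A j, a * (x * y - y * x) * (x * l - l * x) ∈ K)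
    (hy : ∀ a, ∀ l ∈ lowerC A j, a * (x * y - y * x) * (y * l - l * y) ∈ K)
    {ω u : A} (hω : ω ∈ lowerI A 1) (hu : u ∈ lowerC A (j + 1)) : ω * u ∈ K := by
  have hg : ∀ z, (∀ a, ∀ l ∈ lowerC A j, a * (x * y - y * x) * (z * l - l * z) ∈ K) →
      ∀ ω ∈ lowerI A 1, ∀ l ∈ lowerC A j, ω * (z * l - l * z) ∈ K := by
    intro z hz ω hω l hl
    obtain ⟨a, ha⟩ := exists_sub_mul_mem_lowerI_two hgen hω
    have h1 := mul_mem_lowerI hgen 2 (by omega) ha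
      (lowerC_le_lowerI _ (comm_mem_lowerC z hl))
    rw [show 2 + (j + 1) = j + 3 by ring] at h1
    convert K.add_mem (hz a l hl) (hK h1) using 1
    noncomm_ring
  have hc : ∀ c, ∀ ω ∈ lowerI A 1, ∀ l ∈ lowerC A j, ω * (c * l - l * c) ∈ K := by
    intro c
    have ha : c ∈ Algebra.adjoin ℂ {x, y} := hgen ▸ Algebra.mem_top
    induction ha using Algebra.adjoin_induction with
    | mem z hz =>
      rcases hz with rfl | rfl
      · exact hg _ hx
      · exact hg _ hy
    | algebraMap r => exact fun ω _ l _ => by simp [Algebra.commutes r l]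
    | add a b _ _ iha ihb =>
        intro ω hω l hl
        convert K.add_mem (iha ω hω l hl) (ihb ω hω l hl) using 1
        noncomm_ring
    | mul a b _ _ iha ihb =>
        intro ω hω l hl
        have h1 := ihb (ω * a) (mul_right_mem_lowerI a hω) l hl
        have h2 := iha (ω * b) (mul_right_mem_lowerI b hω) l hl
        have h3 := mul_mem_lowerI hgen 1 (by omega) hω
          (lowerC_le_lowerI _ (comm_mem_lowerC b (comm_mem_lowerC a hl)))
        rw [show 1 + (j + 1 + 1) = j + 3 by ring] at h3
        convert K.sub_mem (K.add_mem h1 h2) (hK h3) using 1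
        noncomm_ring
  have : lowerC A (j + 1) ≤ K.comap (LinearMap.mulLeft ℂ ω) :=
    lowerC_succ_le fun a l hl => hc a ω hω l hl
  exact this hu

theorem lowerI_succ_succ_le {j : ℕ} {K : Submodule ℂ A} (hC : lowerC A (j + 2) ≤ K)
    {x y : A} (hgen : Algebra.adjoin ℂ {x, y} = ⊤)
    (hm : ∀ ω ∈ lowerI A 1, ∀ u ∈ lowerC A (j + 1), ω * u ∈ K) : lowerI A (j + 2) ≤ K := by
  refine lowerI_le fun a w hw => ?_
  have : lowerC A (j + 2) ≤ K.comap (LinearMap.mulLeft ℂ a) := by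
    refine lowerC_succ_le fun b l hl => ?_
    have h1 := hC (comm_lowerI hgen (by omega) b (mul_mem_lowerI_of_mem_lowerC a hl))
    have h2 := hm _ (lowerC_le_lowerI 1
      (comm_mem_lowerC b (Submodule.mem_top : a ∈ lowerC A 0))) l hl
    simp only [Submodule.mem_comap, LinearMap.mulLeft_apply]
    convert K.sub_mem h1 h2 using 1
    noncomm_ring
  exact this hw

theorem comm_relation {x y : A} (hgen : Algebra.adjoin ℂ {x, y} = ⊤) {j : ℕ} {R : Submodule ℂ A}
    (hx : lowerC A (j + 2) ≤ R.comap (bracketLeft x))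
    (hy : lowerC A (j + 2) ≤ R.comap (bracketLeft y))
    (hxy : lowerC A (j + 2) ≤ R.comap (bracketLeft (x * y))) (b : A) {l : A}
    (hl : l ∈ lowerC A (j + 1)) :
    bracketLeft x ((b * y - y * b) * l) + bracketLeft y ((b * x - x * b) * l) ∈ R := by
  have h0 := hxy (comm_mem_lowerC b hl)
  have h1 := hx (comm_lowerI hgen (by omega) b (mul_mem_lowerI_of_mem_lowerC y hl))
  have h2 := hy (comm_lowerI hgen (by omega) b
    (mul_right_mem_lowerI x (lowerC_le_lowerI _ hl)))
  have h3 := hy (lowerC_antitone (by omega) (comm_lowerC_lowerC 1 (j + 1)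
    (comm_mem_lowerC b (Submodule.mem_top : x ∈ lowerC A 0)) hl))
  simp only [Submodule.mem_comap, bracketLeft_apply] at h0 h1 h2 h3 ⊢
  convert R.sub_mem (R.add_mem h1 (R.add_mem h2 h3)) h0 using 1
  noncomm_ring

theorem bracketLeft_mul_comm_mem {x y : A} (hgen : Algebra.adjoin ℂ {x, y} = ⊤) {j : ℕ}
    {R : Submodule ℂ A}
    (hx : lowerI A (j + 3) ≤ R.comap (bracketLeft x))
    (hy : lowerI A (j + 3) ≤ R.comap (bracketLeft y))
    (hrel : ∀ b, ∀ l ∈ lowerC A (j + 1),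
      bracketLeft x ((b * y - y * b) * l) + bracketLeft y ((b * x - x * b) * l) ∈ R)
    {l : A} (hl : l ∈ lowerC A j) (a : A) :
    bracketLeft y (a * (x * y - y * x) * (x * l - l * x)) ∈ R ∧
      bracketLeft x (a * (x * y - y * x) * (x * l - l * x)) ∈ R := by
  have hν : x * y - y * x ∈ lowerC A 1 := comm_mem_lowerC x Submodule.mem_top
  have hl1 : x * l - l * x ∈ lowerC A (j + 1) := comm_mem_lowerC x hl
  have hN : ∀ {i k : ℕ} {u v : A}, 1 ≤ k → i + k = j + 3 → u ∈ lowerI A i → v ∈ lowerI A k →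
      u * v ∈ lowerI A (j + 3) := fun hk hik hu hv => hik ▸ mul_mem_lowerI hgen _ hk hu hv
  have hνl : ∀ a ∈ lowerI A 1, a * (x * y - y * x) * (x * l - l * x) ∈ lowerI A (j + 3) :=
    fun a ha => hN (by omega) (by omega) (mul_mem_lowerI hgen 1 le_rfl ha
      (lowerC_le_lowerI 1 hν)) (lowerC_le_lowerI _ hl1)
  have step1 : ∀ a, bracketLeft y (a * (x * y - y * x) * (x * l - l * x)) ∈ R := by
    let Z : Submodule ℂ A := ((R.comap (bracketLeft y)).comap
      (LinearMap.mulRight ℂ (x * l - l * x))).comap (LinearMap.mulRight ℂ (x * y - y * x))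
    refine le_of_monomials_of_lowerI_one (Z := Z) hgen (fun q p => ?_) fun a ha => hy (hνl a ha)
    show y ^ q * x ^ p * (x * y - y * x) * (x * l - l * x) ∈ R.comap (bracketLeft y)
    have h0 : (y ^ (q + 1) * x - x * y ^ (q + 1)) * (x ^ (p + 1) * l - l * x ^ (p + 1)) ∈
        R.comap (bracketLeft y) := by
      simpa [(Commute.pow_self y (q + 1)).eq] using
        hrel (y ^ (q + 1)) _ (comm_mem_lowerC (x ^ (p + 1)) hl)
    have e1 := comm_pow_sub_mem_lowerI (i := 0) y q (Submodule.mem_top (x := x))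
    have e2 := comm_pow_sub_mem_lowerI x p hl
    have m1 := hN (by omega) (by omega) e1
      (lowerC_le_lowerI _ (comm_mem_lowerC (x ^ (p + 1)) hl))
    have m2 := hN (i := 1) (k := j + 2) (by omega) (by omega) (Submodule.smul_mem _ ((q : ℂ) + 1)
      (mul_left_mem_lowerI (y ^ q) (lowerC_le_lowerI _
      (comm_mem_lowerC y (Submodule.mem_top : x ∈ lowerC A 0))))) e2
    have m3 := hN (by omega) (by omega) (mul_left_mem_lowerI (y ^ q) (lowerC_le_lowerI _
      (comm_mem_lowerC (x ^ p) hν))) (lowerC_le_lowerI _ hl1)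
    have h1 := Submodule.sub_mem _ h0 (hy (Submodule.add_mem _ m1 m2))
    have h2 : ((q : ℂ) + 1) • (y ^ q * (y * x - x * y)) * ((p : ℂ) + 1) •
        (x ^ p * (x * l - l * x)) ∈ R.comap (bracketLeft y) := by
      convert h1 using 1
      noncomm_ring
    rw [smul_mul_smul_comm] at h2
    have hne : ((q : ℂ) + 1) * ((p : ℂ) + 1) ≠ 0 :=
      mul_ne_zero (Nat.cast_add_one_ne_zero q) (Nat.cast_add_one_ne_zero p)
    have h3 := (Submodule.smul_mem_iff _ hne).1 h2
    convert Submodule.sub_mem _ (hy m3) h3 using 1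
    noncomm_ring
  refine ⟨step1 a, ?_⟩
  let Z : Submodule ℂ A := ((R.comap (bracketLeft x)).comap
    (LinearMap.mulRight ℂ (x * l - l * x))).comap (LinearMap.mulRight ℂ (x * y - y * x))
  refine le_of_monomials_of_lowerI_one (Z := Z) hgen (fun q p => ?_) (fun a ha => hx (hνl a ha)) a
  show y ^ q * x ^ p * (x * y - y * x) * (x * l - l * x) ∈ R.comap (bracketLeft x)
  have h0 := hrel (y ^ q * x ^ (p + 1)) _ hl1
  obtain ⟨c, hc⟩ := exists_sub_mul_mem_lowerI_two hgen (lowerC_le_lowerI 1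
    (comm_mem_lowerC (y ^ q * x ^ (p + 1)) (Submodule.mem_top : x ∈ lowerC A 0)))
  have h1 := Submodule.add_mem _ (hy (hN (by omega) (by omega) hc (lowerC_le_lowerI _ hl1)))
    (step1 c)
  rw [Submodule.mem_comap, ← add_mul, sub_add_cancel] at h1
  have h2 : (y ^ q * x ^ (p + 1) * y - y * (y ^ q * x ^ (p + 1))) * (x * l - l * x) ∈
      R.comap (bracketLeft x) := by
    simpa using R.sub_mem h0 h1
  have e1 := comm_pow_sub_mem_lowerI (i := 0) x p (Submodule.mem_top (x := y))
  have m1 := hx (hN (by omega) (by omega) (mul_left_mem_lowerI (y ^ q) e1)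
    (lowerC_le_lowerI _ hl1))
  have h3 := Submodule.sub_mem _ h2 m1
  rw [← Submodule.smul_mem_iff _ (Nat.cast_add_one_ne_zero p : (p : ℂ) + 1 ≠ 0)]
  convert h3 using 1
  rw [← mul_assoc y (y ^ q), ← pow_succ', pow_succ y q, mul_sub (y ^ q), mul_smul_comm, ← sub_mul]
  rw [show y ^ q * x ^ (p + 1) * y - y ^ q * y * x ^ (p + 1) =
    y ^ q * (x ^ (p + 1) * y - y * x ^ (p + 1)) by noncomm_ring, sub_sub_cancel, smul_mul_assoc,
    mul_assoc (y ^ q)]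

/-- Modulo `L_{k+2}`, the space `L_{k+1}` is `[x, L_k] + [y, L_k] + [xy, L_k]`, for `k ≥ 2` (in
the indexing from `1`), in an algebra generated by `x` and `y`. -/
theorem lowerC_succ_le_of_generators {x y : A} (hgen : Algebra.adjoin ℂ {x, y} = ⊤) {k : ℕ}
    (hk : 1 ≤ k) {R : Submodule ℂ A} (hR : lowerC A (k + 2) ≤ R)
    (hx : lowerC A k ≤ R.comap (bracketLeft x)) (hy : lowerC A k ≤ R.comap (bracketLeft y))
    (hxy : lowerC A k ≤ R.comap (bracketLeft (x * y))) : lowerC A (k + 1) ≤ R := by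
  obtain rfl | ⟨j, rfl⟩ : k = 1 ∨ ∃ j, k = j + 2 := by
    rcases k with _ | _ | j
    · omega
    · exact .inl rfl
    · exact .inr ⟨j, rfl⟩
  · exact lowerC_succ_le fun c w hw =>
      comm_lowerI_one_mem hgen hR hx hy hxy c (lowerC_le_lowerI 1 hw)
  have hI : ∀ z, lowerI A (j + 3) ≤ R.comap (bracketLeft z) := fun z w hw =>
    hR (comm_lowerI hgen (by omega) z hw)
  have hrel := fun b l (hl : l ∈ lowerC A (j + 1)) => comm_relation hgen hx hy hxy b hl
  have hrel' : ∀ b, ∀ l ∈ lowerC A (j + 1),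
      bracketLeft y ((b * x - x * b) * l) + bracketLeft x ((b * y - y * b) * l) ∈ R :=
    fun b l hl => by rw [add_comm]; exact hrel b l hl
  have hgen' : Algebra.adjoin ℂ {y, x} = ⊤ := by rwa [Set.pair_comm]
  have B := fun a l (hl : l ∈ lowerC A j) =>
    bracketLeft_mul_comm_mem hgen (hI x) (hI y) hrel hl a
  have B' : ∀ a, ∀ l ∈ lowerC A j,
      bracketLeft x (a * (x * y - y * x) * (y * l - l * y)) ∈ R ∧
      bracketLeft y (a * (x * y - y * x) * (y * l - l * y)) ∈ R := fun a l hl => by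
    have h := bracketLeft_mul_comm_mem hgen' (hI y) (hI x) hrel' hl (-a)
    rwa [neg_mul, ← mul_neg, neg_sub] at h
  have hIk : ∀ z, lowerC A (j + 2) ≤ R.comap (bracketLeft z) →
      (∀ a, ∀ l ∈ lowerC A j, bracketLeft z (a * (x * y - y * x) * (x * l - l * x)) ∈ R) →
      (∀ a, ∀ l ∈ lowerC A j, bracketLeft z (a * (x * y - y * x) * (y * l - l * y)) ∈ R) →
      lowerI A (j + 2) ≤ R.comap (bracketLeft z) := fun z hz h1 h2 =>
    lowerI_succ_succ_le hz hgen fun ω hω u hu =>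
      mul_comm_mem_of_left hgen (hI z) h1 h2 hω hu
  exact lowerC_succ_le fun c w hw => comm_mem_of_adjoin hgen
    (fun a w => mul_left_mem_lowerI a) (fun a w => mul_right_mem_lowerI a)
    (hIk x hx (fun a l hl => (B a l hl).2) fun a l hl => (B' a l hl).1)
    (hIk y hy (fun a l hl => (B a l hl).1) fun a l hl => (B' a l hl).2) c
    (lowerC_le_lowerI _ hw)

end LowerCentral

theorem lcs_succ (n k : ℕ) : lcs n (k + 1) = lowerC (FreeAlgebra ℂ (Fin n)) k := by
  induction k with
  | zero => rfl
  | succ k ih => rw [lcs, ih, lowerC]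

theorem mul_mem_gradeComp {n i j : ℕ} {a b : FreeAlgebra ℂ (Fin n)} (ha : a ∈ gradeComp n i)
    (hb : b ∈ gradeComp n j) : a * b ∈ gradeComp n (i + j) := by
  have h : gradeComp n i * gradeComp n j ≤ gradeComp n (i + j) := by
    rw [gradeComp, gradeComp, Submodule.span_mul_span]
    refine Submodule.span_mono ?_
    rintro _ ⟨_, ⟨u, rfl⟩, _, ⟨v, rfl⟩, rfl⟩
    refine ⟨Fin.append u v, ?_⟩
    have : (fun t => FreeAlgebra.ι ℂ (Fin.append u v t)) =
        Fin.append (fun t => FreeAlgebra.ι ℂ (u t)) fun t => FreeAlgebra.ι ℂ (v t) := by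
      funext t
      refine Fin.addCases (fun t => ?_) (fun t => ?_) t <;> simp
    rw [this, List.ofFn_fin_append, List.prod_append]
  exact h (Submodule.mul_mem_mul ha hb)

theorem ι_mem_gradeComp {n : ℕ} (i : Fin n) : FreeAlgebra.ι ℂ i ∈ gradeComp n 1 :=
  Submodule.subset_span ⟨fun _ => i, by simp⟩

instance finiteDimensional_gradeComp (n d : ℕ) : FiniteDimensional ℂ (gradeComp n d) := by
  refine FiniteDimensional.span_of_finite ℂ (Set.Finite.subset (Set.finite_range
    fun w : Fin d → Fin n => (List.ofFn fun i => FreeAlgebra.ι ℂ (w i)).prod) ?_)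
  rintro _ ⟨w, rfl⟩
  exact ⟨w, rfl⟩

/-- The grading of the free algebra, encoded as a map to polynomials over it. -/
noncomputable def gradingHom (n : ℕ) :
    FreeAlgebra ℂ (Fin n) →ₐ[ℂ] Polynomial (FreeAlgebra ℂ (Fin n)) :=
  FreeAlgebra.lift ℂ fun i => Polynomial.C (FreeAlgebra.ι ℂ i) * Polynomial.X

/-- The projection of the free algebra to its degree `d` component. -/
noncomputable def homComp (n d : ℕ) : FreeAlgebra ℂ (Fin n) →ₗ[ℂ] FreeAlgebra ℂ (Fin n) :=
  (Polynomial.lcoeff (FreeAlgebra ℂ (Fin n)) d).restrictScalars ℂ ∘ₗ (gradingHom n).toLinearMap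

theorem homComp_apply {n d : ℕ} (a : FreeAlgebra ℂ (Fin n)) :
    homComp n d a = (gradingHom n a).coeff d := rfl

theorem homComp_mul {n d : ℕ} (a b : FreeAlgebra ℂ (Fin n)) :
    homComp n d (a * b) = 
      ∑ ij ∈ Finset.HasAntidiagonal.antidiagonal d, homComp n ij.1 a * homComp n ij.2 b := by
  simp only [homComp_apply, map_mul, Polynomial.coeff_mul]

theorem homComp_mul_swap {n d : ℕ} (a b : FreeAlgebra ℂ (Fin n)) :
    homComp n d (b * a) = 
      ∑ ij ∈ Finset.HasAntidiagonal.antidiagonal d, homComp n ij.2 b * homComp n ij.1 a := by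
  rw [homComp_mul, ← Finset.Nat.sum_antidiagonal_swap]
  rfl

theorem gradingHom_of_mem {n d : ℕ} {a : FreeAlgebra ℂ (Fin n)} (ha : a ∈ gradeComp n d) :
    gradingHom n a = Polynomial.monomial d a := by
  induction ha using Submodule.span_induction with
  | mem _ h =>
    obtain ⟨w, rfl⟩ := h
    induction d with
    | zero => simp
    | succ d ih =>
      rw [List.ofFn_succ, List.prod_cons, map_mul, ih fun i => w i.succ, gradingHom,
        FreeAlgebra.lift_ι_apply, Polynomial.C_mul_X_eq_monomial, Polynomial.monomial_mul_monomial,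
        add_comm 1 d]
  | zero => simp
  | add a b _ _ iha ihb => rw [map_add, map_add, iha, ihb]
  | smul r a _ ih => rw [map_smul, ih, Polynomial.smul_monomial]

theorem homComp_of_mem {n d : ℕ} {a : FreeAlgebra ℂ (Fin n)} (ha : a ∈ gradeComp n d) :
    homComp n d a = a := by
  rw [homComp_apply, gradingHom_of_mem ha, Polynomial.coeff_monomial_same]

theorem homComp_mem_gradeComp {n : ℕ} (d : ℕ) (a : FreeAlgebra ℂ (Fin n)) :
    homComp n d a ∈ gradeComp n d := by
  have hof : ∀ {e : ℕ} {a : FreeAlgebra ℂ (Fin n)}, a ∈ gradeComp n e →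
      ∀ d, homComp n d a ∈ gradeComp n d := fun {e a} ha d => by
    rw [homComp_apply, gradingHom_of_mem ha, Polynomial.coeff_monomial]
    split_ifs with h
    · exact h ▸ ha
    · exact Submodule.zero_mem _
  induction a using FreeAlgebra.induction generalizing d with
  | grade0 r =>
    refine hof (e := 0) ?_ d
    rw [Algebra.algebraMap_eq_smul_one]
    exact Submodule.smul_mem _ r (Submodule.subset_span ⟨Fin.elim0, by simp⟩)
  | grade1 i => exact hof (ι_mem_gradeComp i) d
  | mul a b iha ihb =>
    rw [homComp_mul]
    refine Submodule.sum_mem _ fun ij hij => ?_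
    rw [← Finset.HasAntidiagonal.mem_antidiagonal.1 hij]
    exact mul_mem_gradeComp (iha _) (ihb _)
  | add a b iha ihb =>
    rw [map_add]
    exact Submodule.add_mem _ (iha d) (ihb d)

theorem homComp_mem_lowerC {n k : ℕ} (d : ℕ) {a : FreeAlgebra ℂ (Fin n)}
    (ha : a ∈ lowerC (FreeAlgebra ℂ (Fin n)) k) :
    homComp n d a ∈ lowerC (FreeAlgebra ℂ (Fin n)) k := by
  induction k generalizing d a with
  | zero => exact Submodule.mem_top
  | succ k ih =>
    have : lowerC (FreeAlgebra ℂ (Fin n)) (k + 1) ≤ (lowerC _ (k + 1)).comap (homComp n d) := by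
      refine lowerC_succ_le fun b w hw => ?_
      rw [Submodule.mem_comap, map_sub, homComp_mul, homComp_mul_swap b w, ← Finset.sum_sub_distrib]
      exact Submodule.sum_mem _ fun ij _ => comm_mem_lowerC _ (ih _ hw)
    exact this ha

theorem homComp_bracketLeft {n e : ℕ} {s : FreeAlgebra ℂ (Fin n)} (hs : s ∈ gradeComp n e) (d : ℕ)
    (w : FreeAlgebra ℂ (Fin n)) :
    homComp n (d + e) (bracketLeft s w) = bracketLeft s (homComp n d w) := by
  simp only [bracketLeft_apply, homComp_apply, map_sub, map_mul, gradingHom_of_mem hs,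
    Polynomial.coeff_monomial_mul, Polynomial.coeff_mul_monomial]

/-- The degree `d` component of the `(k+1)`-st term of the lower central series. -/
def gradedLower (n k d : ℕ) : Submodule ℂ (FreeAlgebra ℂ (Fin n)) :=
  lowerC (FreeAlgebra ℂ (Fin n)) k ⊓ gradeComp n d

instance finiteDimensional_gradedLower (n k d : ℕ) : FiniteDimensional ℂ (gradedLower n k d) :=
  Submodule.finiteDimensional_of_le inf_le_right

theorem map_bracketLeft_gradedLower_le {n e : ℕ} {s : FreeAlgebra ℂ (Fin n)}
    (hs : s ∈ gradeComp n e) (k d : ℕ) :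
    (gradedLower n k d).map (bracketLeft s) ≤ gradedLower n (k + 1) (d + e) := by
  rintro _ ⟨w, hw, rfl⟩
  refine ⟨comm_mem_lowerC s hw.1, Submodule.sub_mem _ ?_ (mul_mem_gradeComp hw.2 hs)⟩
  rw [add_comm]
  exact mul_mem_gradeComp hs hw.2

theorem homComp_mem_gradedLower {n k : ℕ} (d : ℕ) {a : FreeAlgebra ℂ (Fin n)}
    (ha : a ∈ lowerC (FreeAlgebra ℂ (Fin n)) k) : homComp n d a ∈ gradedLower n k d :=
  ⟨homComp_mem_lowerC d ha, homComp_mem_gradeComp d a⟩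

theorem adjoin_ι_fin_two :
    Algebra.adjoin ℂ {FreeAlgebra.ι ℂ (0 : Fin 2), FreeAlgebra.ι ℂ (1 : Fin 2)} = ⊤ := by
  rw [← FreeAlgebra.adjoin_range_ι]
  congr 1
  ext
  simp [eq_comm]

theorem gradedLower_succ_le {k : ℕ} (hk : 1 ≤ k) (d : ℕ) :
    gradedLower 2 (k + 1) (d + 2) ≤
      (gradedLower 2 k (d + 1)).map (bracketLeft (FreeAlgebra.ι ℂ 0)) ⊔
        (gradedLower 2 k (d + 1)).map (bracketLeft (FreeAlgebra.ι ℂ 1)) ⊔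
        (gradedLower 2 k d).map (bracketLeft (FreeAlgebra.ι ℂ 0 * FreeAlgebra.ι ℂ 1)) ⊔
        gradedLower 2 (k + 2) (d + 2) := by
  rintro a ⟨ha, had⟩
  rw [← homComp_of_mem had, ← Submodule.mem_comap]
  refine lowerC_succ_le_of_generators adjoin_ι_fin_two hk ?_ ?_ ?_ ?_ ha
  · exact fun w hw => Submodule.mem_sup_right (homComp_mem_gradedLower _ hw)
  · intro w hw
    rw [Submodule.mem_comap, Submodule.mem_comap, homComp_bracketLeft (ι_mem_gradeComp 0) (d + 1)]
    exact Submodule.mem_sup_left (Submodule.mem_sup_left (Submodule.mem_sup_left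
      ⟨_, homComp_mem_gradedLower _ hw, rfl⟩))
  · intro w hw
    rw [Submodule.mem_comap, Submodule.mem_comap, homComp_bracketLeft (ι_mem_gradeComp 1) (d + 1)]
    exact Submodule.mem_sup_left (Submodule.mem_sup_left (Submodule.mem_sup_right
      ⟨_, homComp_mem_gradedLower _ hw, rfl⟩))
  · intro w hw
    rw [Submodule.mem_comap, Submodule.mem_comap, homComp_bracketLeft
      (mul_mem_gradeComp (ι_mem_gradeComp 0) (ι_mem_gradeComp 1)) d]
    exact Submodule.mem_sup_left (Submodule.mem_sup_right ⟨_, homComp_mem_gradedLower _ hw, rfl⟩)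

theorem finrank_map_le_finrank_quotient {V W : Type*} [AddCommGroup V] [Module ℂ V]
    [AddCommGroup W] [Module ℂ W] (F G : Submodule ℂ V) [FiniteDimensional ℂ F] (g : V →ₗ[ℂ] W)
    (hg : G ≤ LinearMap.ker g) :
    Module.finrank ℂ (F.map g) ≤ Module.finrank ℂ (F ⧸ G.comap F.subtype) := by
  have h : G.comap F.subtype ≤ LinearMap.ker (g ∘ₗ F.subtype) := fun v hv => hg hv
  have hr : F.map g = LinearMap.range ((G.comap F.subtype).liftQ (g ∘ₗ F.subtype) h) := by
    rw [Submodule.range_liftQ, LinearMap.range_comp, Submodule.range_subtype]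
  rw [hr]
  exact LinearMap.finrank_range_le _

theorem finrank_quotient_comap_subtype {V : Type*} [AddCommGroup V] [Module ℂ V]
    (F G : Submodule ℂ V) :
    Module.finrank ℂ (F ⧸ G.comap F.subtype) = Module.finrank ℂ (F.map G.mkQ) := by
  have hk : LinearMap.ker (G.mkQ ∘ₗ F.subtype) = G.comap F.subtype := by
    rw [LinearMap.ker_comp, Submodule.ker_mkQ]
  have hr : LinearMap.range (G.mkQ ∘ₗ F.subtype) = F.map G.mkQ := by
    rw [LinearMap.range_comp, Submodule.range_subtype]
  rw [← hk, ← hr]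
  exact (LinearMap.quotKerEquivRange _).finrank_eq

theorem dimB_succ (n k d : ℕ) : dimB n (k + 1) d = Module.finrank ℂ
    (gradedLower n k d ⧸ (gradedLower n (k + 1) d).comap (gradedLower n k d).subtype) := by
  rw [dimB, lcs_succ, lcs_succ]
  rfl

theorem finrank_map_mkQ_bracketLeft_le {n e : ℕ} {s : FreeAlgebra ℂ (Fin n)}
    (hs : s ∈ gradeComp n e) (k d : ℕ) :
    Module.finrank ℂ ((gradedLower n k d).map
      ((gradedLower n (k + 2) (d + e)).mkQ ∘ₗ bracketLeft s)) ≤ dimB n (k + 1) d := by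
  rw [dimB_succ]
  refine finrank_map_le_finrank_quotient _ _ _ ?_
  rw [LinearMap.ker_comp, Submodule.ker_mkQ, ← Submodule.map_le_iff_le_comap]
  exact map_bracketLeft_gradedLower_le hs (k + 1) d

/-- The recursive bound `dim B_{k+2}[d+2] ≤ 2 dim B_{k+1}[d+1] + dim B_{k+1}[d]`. -/
theorem dimB_two_succ_le {k : ℕ} (hk : 1 ≤ k) (d : ℕ) :
    dimB 2 (k + 2) (d + 2) ≤ 2 * dimB 2 (k + 1) (d + 1) + dimB 2 (k + 1) d := by
  have hx := finrank_map_mkQ_bracketLeft_le (ι_mem_gradeComp (0 : Fin 2)) k (d + 1)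
  have hy := finrank_map_mkQ_bracketLeft_le (ι_mem_gradeComp (1 : Fin 2)) k (d + 1)
  have hxy := finrank_map_mkQ_bracketLeft_le
    (mul_mem_gradeComp (ι_mem_gradeComp (0 : Fin 2)) (ι_mem_gradeComp 1)) k d
  have hle := Submodule.map_mono (f := (gradedLower 2 (k + 2) (d + 2)).mkQ)
    (gradedLower_succ_le hk d)
  rw [Submodule.map_sup, Submodule.map_sup, Submodule.map_sup, Submodule.mkQ_map_self,
    sup_bot_eq, ← Submodule.map_comp, ← Submodule.map_comp, ← Submodule.map_comp] at hle
  rw [dimB_succ, finrank_quotient_comap_subtype]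
  refine (Submodule.finrank_mono hle).trans ?_
  refine (Submodule.finrank_add_le_finrank_add_finrank _ _).trans ?_
  refine (Nat.add_le_add_right (Submodule.finrank_add_le_finrank_add_finrank _ _) _).trans ?_
  rw [two_mul]
  exact Nat.add_le_add (Nat.add_le_add hx hy) hxy

theorem leadingCoeff_le_three_mul {p q : Polynomial ℝ} (hp : p.degree = 1) (hq : q.degree = 1)
    {D : ℕ} (h : ∀ d : ℕ, D ≤ d →
      q.eval ((d : ℝ) + 2) ≤ 2 * p.eval ((d : ℝ) + 1) + p.eval (d : ℝ)) :
    q.leadingCoeff ≤ 3 * p.leadingCoeff := by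
  have hp' : p.natDegree = 1 := Polynomial.natDegree_eq_of_degree_eq_some hp
  have hq' : q.natDegree = 1 := Polynomial.natDegree_eq_of_degree_eq_some hq
  rw [Polynomial.leadingCoeff, Polynomial.leadingCoeff, hp', hq']
  rw [Polynomial.eq_X_add_C_of_natDegree_le_one hp'.le,
    Polynomial.eq_X_add_C_of_natDegree_le_one hq'.le] at h
  simp only [Polynomial.eval_add, Polynomial.eval_mul, Polynomial.eval_C, Polynomial.eval_X] at h
  by_contra! hlt
  obtain ⟨N, hN⟩ := exists_nat_gt
    ((2 * p.coeff 1 + 3 * p.coeff 0 - 2 * q.coeff 1 - q.coeff 0) / (q.coeff 1 - 3 * p.coeff 1))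
  rw [div_lt_iff₀ (by linarith)] at hN
  have hd := h (max D N) (le_max_left _ _)
  have hm : (N : ℝ) ≤ (max D N : ℕ) := by exact_mod_cast le_max_right D N
  nlinarith

/-- if `p, q` are real polynomials of degree 1 with
`dim B_m(A_2)[d] = p(d)` and `dim B_{m+1}(A_2)[d] = q(d)` for all large `d`, then the
leading coefficient of `q` is at most 3 times that of `p`: `a_{m+1,2} ≤ 3 a_{m,2}`. -/
theorem stmt_19 (m : ℕ) (hm : 2 ≤ m) (p q : Polynomial ℝ)
    (hp : p.degree = 1) (hq : q.degree = 1)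
    (h : ∃ D : ℕ, ∀ d : ℕ, D ≤ d →
      (dimB 2 m d : ℝ) = p.eval (d : ℝ) ∧ (dimB 2 (m + 1) d : ℝ) = q.eval (d : ℝ)) :
    q.leadingCoeff ≤ 3 * p.leadingCoeff := by
  obtain ⟨D, hD⟩ := h
  obtain ⟨k, rfl⟩ := Nat.exists_eq_add_of_le' (Nat.le_of_succ_le hm)
  refine leadingCoeff_le_three_mul hp hq (D := D) fun d hd => ?_
  have h0 := (hD d hd).1
  have h1 := (hD (d + 1) (by omega)).1
  have h2 := (hD (d + 2) (by omega)).2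
  push_cast at h1 h2
  rw [← h0, ← h1, ← h2]
  exact_mod_cast dimB_two_succ_le (Nat.le_of_succ_le_succ hm) d
end
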